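/- arXiv:2008.13765 — 7 statements merged into one kernel-verified Lean document; each statement's English description precedes it below -/
import Mathlib

section
/- Fix positive integers m, r with n = m + r, and fix an integer d with 0 ≤ d ≤ min{m, r}. Then γ_B − d·α^∨_m lies in the ℤ-span of {α^∨_i : i ∈ [n−1], i ≠ m}, and ⟨γ_B, α⟩ ∈ {0, −1} for every α ∈ R_P^+. -/
noncomputable section

/-- The standard basis vector `e_i` of `ℝ^n` (coordinates indexed `1, …, n`). -/
def evec (i : ℕ) : ℕ → ℝ := fun j => if j = i then 1 else 0

/-- The simple (co)root `α_i = α_i^∨ = e_i − e_{i+1}`. -/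
def alphaVec (i : ℕ) : ℕ → ℝ := evec i - evec (i + 1)

/-- The standard inner product on `ℝ^n` (coordinates `1, …, n`). -/
def ip (n : ℕ) (x y : ℕ → ℝ) : ℝ := ∑ j ∈ Finset.Icc 1 n, x j * y j

/-- `γ_B = Σ_{i=1}^{d−1} i·(α^∨_{m−d+i} + α^∨_{m+d−i}) + d·α^∨_m`. -/
def gammaB (m d : ℕ) : ℕ → ℝ :=
  (∑ i ∈ Finset.Icc 1 (d - 1), (i : ℝ) • (alphaVec (m - d + i) + alphaVec (m + d - i)))
    + (d : ℝ) • alphaVec m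

theorem sumA (a t k : ℕ) :
    ∑ i ∈ Finset.Icc 1 t, (i : ℝ) * alphaVec (a + i) k =
      (if a < k ∧ k ≤ a + t then 1 else 0) - (if k = a + t + 1 then (t : ℝ) else 0) := by
  induction t with
  | zero =>
    have : ¬ (a < k ∧ k ≤ a) := by omega
    simp [this]
  | succ t ih =>
    rw [Finset.sum_Icc_succ_top (by omega), ih]
    simp only [alphaVec, evec, Pi.sub_apply]
    push_cast
    split_ifs <;> first | omega | ring

theorem sumB (b t k : ℕ) (h : t ≤ b) :
    ∑ i ∈ Finset.Icc 1 t, (i : ℝ) * alphaVec (b - i) k =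
      (if k = b - t then (t : ℝ) else 0) - (if b - t < k ∧ k ≤ b then 1 else 0) := by
  induction t with
  | zero =>
    have : ¬ (b < k ∧ k ≤ b) := by omega
    simp [this]
  | succ t ih =>
    rw [Finset.sum_Icc_succ_top (by omega), ih (by omega)]
    simp only [alphaVec, evec, Pi.sub_apply]
    push_cast
    split_ifs <;> first | omega | ring

theorem gammaB_apply (m d k : ℕ) (hdm : d ≤ m) :
    gammaB m d k = (if m - d < k ∧ k ≤ m then 1 else 0)
      - (if m < k ∧ k ≤ m + d then 1 else 0) := by
  have h : gammaB m d k = (∑ i ∈ Finset.Icc 1 (d - 1), (i : ℝ) * alphaVec (m - d + i) k)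
      + (∑ i ∈ Finset.Icc 1 (d - 1), (i : ℝ) * alphaVec (m + d - i) k)
      + (d : ℝ) * alphaVec m k := by
    simp [gammaB, Finset.sum_apply, Finset.sum_add_distrib]
  rw [h, sumA, sumB _ _ _ (by omega)]
  obtain _ | t := d
  · have h1 : ¬ (m < k ∧ k ≤ m) := by omega
    simp [h1]
  · simp only [alphaVec, evec, Pi.sub_apply, Nat.add_sub_cancel]
    push_cast
    split_ifs <;> first | omega | ring

theorem ip_evec (n i j : ℕ) (x : ℕ → ℝ) (hi : 1 ≤ i) (hin : i ≤ n) (hj : 1 ≤ j) (hjn : j ≤ n) :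
    ip n x (evec i - evec j) = x i - x j := by
  simp [ip, evec, mul_sub, Finset.sum_sub_distrib, hi, hin, hj, hjn]

/-- `γ_B` projects to `d·α^∨_m` modulo `Q_P^∨`, and `⟨γ_B, α⟩ ∈ {0, −1}` for all
`α ∈ R_P^+ = {e_i − e_j : 1 ≤ i < j ≤ m or m+1 ≤ i < j ≤ n}`. -/
theorem stmt2 (m r n d : ℕ) (hm : 0 < m) (hr : 0 < r) (hn : n = m + r)
    (hdm : d ≤ m) (hdr : d ≤ r) :
    (gammaB m d - (d : ℝ) • alphaVec m ∈
      Submodule.span ℤ {v : ℕ → ℝ | ∃ i, 1 ≤ i ∧ i ≤ n - 1 ∧ i ≠ m ∧ v = alphaVec i}) ∧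
    (∀ i j, ((1 ≤ i ∧ i < j ∧ j ≤ m) ∨ (m + 1 ≤ i ∧ i < j ∧ j ≤ n)) →
      ip n (gammaB m d) (evec i - evec j) = 0 ∨
      ip n (gammaB m d) (evec i - evec j) = -1) := by
  constructor
  · have h : gammaB m d - (d : ℝ) • alphaVec m = ∑ i ∈ Finset.Icc 1 (d - 1),
        (i : ℤ) • (alphaVec (m - d + i) + alphaVec (m + d - i)) := by
      rw [gammaB, add_sub_cancel_right]
      refine Finset.sum_congr rfl fun i _ => ?_
      ext k
      simp [mul_add]
    rw [h]
    refine Submodule.sum_mem _ fun i hi => Submodule.smul_mem _ _ (Submodule.add_mem _ ?_ ?_)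
    all_goals
      rw [Finset.mem_Icc] at hi
      refine Submodule.subset_span ⟨_, ?_, ?_, ?_, rfl⟩ <;> omega
  · intro i j hij
    rw [ip_evec n i j _ (by omega) (by omega) (by omega) (by omega),
      gammaB_apply m d i hdm, gammaB_apply m d j hdm]
    split_ifs <;> first | omega | norm_num

end
end

section
/- Let w ∈ S_n have descent set D(w) = {a, b} with 1 ≤ a < b < n. Then (λ̃_w^↓)′ = (2n−a−b−Inv_1(w), …, 2n−a−b−Inv_a(w), n−b−Inv_{a+1}(w), …, n−b−Inv_b(w)). -/
/-- `Inv_i(w) = #{p : i < p ≤ n, w(i) > w(p)}`. -/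
def Invi (n : ℕ) (w : ℕ → ℕ) (i : ℕ) : ℕ :=
  ((Finset.Icc (i + 1) n).filter (fun p => w p < w i)).card

/-- `ζ_i(w) = Inv_i(w_0 w) + binom(n−i, 2)`, where `(w_0 w)(x) = n+1−w(x)`. -/
def zeta (n : ℕ) (w : ℕ → ℕ) (i : ℕ) : ℕ :=
  Invi n (fun x => n + 1 - w x) i + Nat.choose (n - i) 2

/-- The `(n−1)`-bounded partition `λ̃_w = ζ(w)′`, recorded as the multiset of its
(positive) parts. -/
def lamTildeM (n : ℕ) (w : ℕ → ℕ) : Multiset ℕ :=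
  ((Finset.Icc 1 (n * n)).val.map
    (fun i => ((Finset.Icc 1 (n - 1)).filter (fun p => i ≤ zeta n w p)).card)).filter
      (fun x => 0 < x)

/-- The `k`-rectangle `R_i = (i^{n−i})` (here `k = n−1`), as a multiset of parts. -/
def kRect (n i : ℕ) : Multiset ℕ := Multiset.replicate (n - i) i

/-- A `k`-bounded partition (as a multiset of parts) is irreducible if no
`k`-rectangle is removable from it. -/
def IrreducibleK (n : ℕ) (μ : Multiset ℕ) : Prop :=
  ∀ i, 1 ≤ i → i ≤ n - 1 → ¬ kRect n i ≤ μ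

/-- One removal of a `k`-rectangle. -/
def RemStep (n : ℕ) (μ ν : Multiset ℕ) : Prop :=
  ∃ i, 1 ≤ i ∧ i ≤ n - 1 ∧ μ = ν + kRect n i

/-- `ν` is an irreducible partition obtained from `μ` by successively removing
removable `k`-rectangles; i.e. `ν = μ^↓`. -/
def ReachesIrred (n : ℕ) (μ ν : Multiset ℕ) : Prop :=
  Relation.ReflTransGen (RemStep n) μ ν ∧ IrreducibleK n ν

/-- The transpose of a partition given as a multiset of parts: `i ↦ #{parts ≥ i}`. -/
def mT (μ : Multiset ℕ) (i : ℕ) : ℕ := (μ.filter (fun x => i ≤ x)).card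

theorem aux_Invi_le (n : ℕ) (w : ℕ → ℕ) (i : ℕ) : Invi n w i ≤ n - i := by
  unfold Invi
  refine (Finset.card_filter_le _ _).trans ?_
  simp

theorem aux_Invi_asc (n : ℕ) (w : ℕ → ℕ) (i : ℕ) (h : w i < w (i + 1)) :
    Invi n w i ≤ Invi n w (i + 1) := by
  unfold Invi
  apply Finset.card_le_card
  intro p hp
  simp only [Finset.mem_filter, Finset.mem_Icc] at hp ⊢
  have : p ≠ i + 1 := by
    rintro rfl
    omega
  omega

theorem aux_Invi_desc (n : ℕ) (w : ℕ → ℕ) (i : ℕ) (hi : i < n) (h : w (i + 1) < w i) :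
    Invi n w (i + 1) < Invi n w i := by
  unfold Invi
  apply Finset.card_lt_card
  rw [Finset.ssubset_iff_of_subset]
  · refine ⟨i + 1, ?_, ?_⟩
    · simp only [Finset.mem_filter, Finset.mem_Icc]
      omega
    · simp only [Finset.mem_filter, Finset.mem_Icc]
      omega
  · intro p hp
    simp only [Finset.mem_filter, Finset.mem_Icc] at hp ⊢
    omega

theorem aux_compl (n : ℕ) (w : Equiv.Perm ℕ) (hwout : ∀ i, i = 0 ∨ n < i → w i = i)
    (i : ℕ) (hi1 : 1 ≤ i) (hin : i ≤ n) :
    Invi n (fun x => n + 1 - w x) i + Invi n (fun x => w x) i = n - i := by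
  have hb : ∀ p, p ≤ n → w p ≤ n := by
    intro p hp
    by_contra hc
    have h1 := hwout (w p) (Or.inr (by omega))
    have h2 := w.injective h1
    omega
  unfold Invi
  have h : (Finset.Icc (i + 1) n).filter (fun p => n + 1 - w p < n + 1 - w i)
      = (Finset.Icc (i + 1) n).filter (fun p => ¬ w p < w i) := by
    apply Finset.filter_congr
    intro p hp
    simp only [Finset.mem_Icc] at hp
    have h1 := hb p hp.2
    have h2 := hb i hin
    have h3 : w p ≠ w i := by
      intro h
      have := w.injective h
      omega
    omega
  show ((Finset.Icc (i + 1) n).filter (fun p => n + 1 - w p < n + 1 - w i)).card + _ = _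
  rw [h, add_comm, Finset.card_filter_add_card_filter_not]
  simp

theorem aux_zeta_step (n : ℕ) (w : Equiv.Perm ℕ) (hwout : ∀ i, i = 0 ∨ n < i → w i = i)
    (i : ℕ) (hi1 : 1 ≤ i) (hin : i < n) :
    zeta n (fun x => w x) i + Invi n (fun x => w x) i
      = zeta n (fun x => w x) (i + 1) + Invi n (fun x => w x) (i + 1) + (n - i) := by
  have h1 := aux_compl n w hwout i hi1 hin.le
  have h2 := aux_compl n w hwout (i + 1) (by omega) hin
  unfold zeta
  have h3 : Nat.choose (n - i) 2 = (n - (i + 1)) + Nat.choose (n - (i + 1)) 2 := by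
    obtain ⟨m, hm⟩ : ∃ m, n - i = m + 1 := ⟨n - i - 1, by omega⟩
    have hm2 : n - (i + 1) = m := by omega
    rw [hm, hm2, Nat.choose_succ_succ' m 1, Nat.choose_one_right]
  beta_reduce at h1 h2 ⊢
  omega

theorem aux_zeta_le (n : ℕ) (w : ℕ → ℕ) (i : ℕ) : zeta n w i ≤ n * n := by
  unfold zeta
  have h1 := aux_Invi_le n (fun x => n + 1 - w x) i
  have h2 : (n - i) + Nat.choose (n - i) 2 ≤ n * n := by
    have hm : n - i ≤ n := Nat.sub_le _ _
    generalize n - i = m at hm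
    rw [Nat.choose_two_right]
    have h3 : m * (m - 1) + 2 * m ≤ 2 * (m * m) := by
      cases m with
      | zero => simp
      | succ k => simp only [Nat.add_sub_cancel]; nlinarith
    have h4 : m * m ≤ n * n := Nat.mul_le_mul hm hm
    omega
  omega

theorem aux_card (N : ℕ) (f : ℕ → ℕ) (hf : ∀ p q, 1 ≤ p → p ≤ q → q ≤ N + 1 → f q ≤ f p)
    (h0 : f (N + 1) = 0) (i j : ℕ) (hi : 1 ≤ i) (hj : 1 ≤ j) (hjN : j ≤ N) :
    ((Finset.Icc 1 N).filter (fun p => i ≤ f p)).card = j ↔ f (j + 1) < i ∧ i ≤ f j := by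
  constructor
  · intro h
    constructor
    · by_contra hc
      push Not at hc
      have hjN' : j + 1 ≤ N := by
        rcases Nat.lt_or_ge j N with h | h
        · exact h
        · have : j = N := by omega
          subst this
          omega
      have hs : Finset.Icc 1 (j + 1) ⊆ (Finset.Icc 1 N).filter (fun p => i ≤ f p) := by
        intro p hp
        simp only [Finset.mem_filter, Finset.mem_Icc] at hp ⊢
        have := hf p (j + 1) hp.1 hp.2 (by omega)
        omega
      have := Finset.card_le_card hs
      simp at this
      omega
    · by_contra hc
      have hs : (Finset.Icc 1 N).filter (fun p => i ≤ f p) ⊆ Finset.Icc 1 (j - 1) := by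
        intro p hp
        simp only [Finset.mem_filter, Finset.mem_Icc] at hp ⊢
        by_contra hlt
        have := hf j p hj (by omega) (by omega)
        omega
      have := Finset.card_le_card hs
      simp at this
      omega
  · rintro ⟨h1, h2⟩
    have hs : (Finset.Icc 1 N).filter (fun p => i ≤ f p) = Finset.Icc 1 j := by
      ext p
      simp only [Finset.mem_filter, Finset.mem_Icc]
      constructor
      · rintro ⟨h3, h4⟩
        refine ⟨h3.1, ?_⟩
        by_contra hlt
        have := hf (j + 1) p (by omega) (by omega) (by omega)
        omega
      · rintro ⟨h3, h4⟩
        have := hf p j h3 h4 (by omega)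
        omega
    rw [hs]
    simp

theorem aux_anti (n : ℕ) (w : Equiv.Perm ℕ) (hwout : ∀ i, i = 0 ∨ n < i → w i = i)
    (p q : ℕ) (hp : 1 ≤ p) (hpq : p ≤ q) (hq : q ≤ n) :
    zeta n (fun x => w x) q ≤ zeta n (fun x => w x) p := by
  induction q, hpq using Nat.le_induction with
  | base => exact le_rfl
  | succ q hpq ih =>
    have h1 := ih (by omega)
    have h2 := aux_zeta_step n w hwout q (by omega) (by omega)
    have h3 := aux_Invi_le n (fun x => w x) q
    omega

theorem aux_zeta_n (n : ℕ) (w : ℕ → ℕ) : zeta n w n = 0 := by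
  simp [zeta, Invi]

theorem aux_count (n : ℕ) (w : Equiv.Perm ℕ) (hwout : ∀ i, i = 0 ∨ n < i → w i = i)
    (j : ℕ) (hj : 1 ≤ j) (hjn : j < n) :
    Multiset.count j (lamTildeM n (fun x => w x))
      = zeta n (fun x => w x) j - zeta n (fun x => w x) (j + 1) := by
  unfold lamTildeM
  rw [Multiset.count_filter_of_pos (by omega), Multiset.count_map]
  have h : (Finset.Icc 1 (n * n)).filter (fun i =>
      j = ((Finset.Icc 1 (n - 1)).filter (fun p => i ≤ zeta n (fun x => w x) p)).card)
      = Finset.Ioc (zeta n (fun x => w x) (j + 1)) (zeta n (fun x => w x) j) := by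
    ext i
    simp only [Finset.mem_filter, Finset.mem_Icc, Finset.mem_Ioc]
    have hn : n - 1 + 1 = n := by omega
    have key := fun hi => aux_card (n - 1) (zeta n (fun x => w x))
      (fun p q h1 h2 h3 => aux_anti n w hwout p q h1 h2 (by omega))
      (by rw [hn]; exact aux_zeta_n _ _) i j hi hj (by omega)
    constructor
    · rintro ⟨h1, h2⟩
      exact (key h1.1).1 h2.symm
    · rintro ⟨h1, h2⟩
      have := aux_zeta_le n (fun x => w x) j
      exact ⟨⟨by omega, by omega⟩, ((key (by omega)).2 ⟨h1, h2⟩).symm⟩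
  have hc := congrArg Finset.card h
  rw [Nat.card_Ioc] at hc
  exact hc

theorem aux_mem_lt (n : ℕ) (w : ℕ → ℕ) (hn : 0 < n) (x : ℕ) (hx : x ∈ lamTildeM n w) : x < n := by
  unfold lamTildeM at hx
  rw [Multiset.mem_filter, Multiset.mem_map] at hx
  obtain ⟨⟨i, _, rfl⟩, _⟩ := hx
  have := Finset.card_filter_le (Finset.Icc 1 (n - 1)) (fun p => i ≤ zeta n w p)
  simp at this
  omega

theorem aux_reach (n : ℕ) (μ ν : Multiset ℕ) (h : Relation.ReflTransGen (RemStep n) μ ν) :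
    ν ≤ μ ∧ ∀ j, Multiset.count j μ ≡ Multiset.count j ν [MOD (n - j)] := by
  induction h with
  | refl => exact ⟨le_rfl, fun j => rfl⟩
  | tail _ hs ih =>
    obtain ⟨i, _, _, rfl⟩ := hs
    refine ⟨le_trans (Multiset.le_add_right _ _) ih.1, fun j => (ih.2 j).trans ?_⟩
    rw [Multiset.count_add, kRect, Multiset.count_replicate]
    split_ifs with hij
    · subst hij
      exact Nat.add_modEq_right
    · rfl

theorem aux_mT (ρ : Multiset ℕ) (i : ℕ) : mT ρ i = Multiset.count i ρ + mT ρ (i + 1) := by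
  unfold mT
  induction ρ using Multiset.induction with
  | empty => simp
  | cons x s ih =>
    simp only [Multiset.filter_cons, Multiset.count_cons, Multiset.card_add]
    rw [ih]
    rcases lt_trichotomy i x with h | h | h
    · have h1 : i ≤ x := by omega
      have h2 : i + 1 ≤ x := by omega
      have h3 : i ≠ x := by omega
      simp only [h1, h2, h3, if_true, if_false, Multiset.card_singleton]
      omega
    · subst h
      simp
      omega
    · have h1 : ¬ i ≤ x := by omega
      have h2 : ¬ i + 1 ≤ x := by omega
      have h3 : i ≠ x := by omega
      simp only [h1, h2, h3, if_false, Multiset.card_zero]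
      omega

/-- Equation (eq:eta'): for `w ∈ S_n` with `D(w) = {a, b}`,
`(λ̃_w^↓)′ = (2n−a−b−Inv_1(w), …, 2n−a−b−Inv_a(w), n−b−Inv_{a+1}(w), …, n−b−Inv_b(w))`. -/
theorem stmt7 (n a b : ℕ) (ha : 1 ≤ a) (hab : a < b) (hbn : b < n)
    (w : Equiv.Perm ℕ)
    (hwout : ∀ i, i = 0 ∨ n < i → w i = i)
    (hwdes : {i : ℕ | 1 ≤ i ∧ i ≤ n - 1 ∧ w (i + 1) < w i} = {a, b}) :
    ∀ ρ : Multiset ℕ, ReachesIrred n (lamTildeM n (fun x => w x)) ρ →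
      (∀ i, 1 ≤ i → i ≤ a → mT ρ i = 2 * n - a - b - Invi n (fun x => w x) i) ∧
      (∀ i, a < i → i ≤ b → mT ρ i = n - b - Invi n (fun x => w x) i) ∧
      (∀ i, b < i → mT ρ i = 0) := by
  intro ρ hρ
  obtain ⟨hr, hirr⟩ := hρ
  obtain ⟨hle, hmod⟩ := aux_reach _ _ _ hr
  have hdes : ∀ i, 1 ≤ i → i < n → (w (i + 1) < w i ↔ i = a ∨ i = b) := by
    intro i h1 h2
    have h := Set.ext_iff.1 hwdes i
    simp only [Set.mem_setOf_eq, Set.mem_insert_iff, Set.mem_singleton_iff] at h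
    rw [← h]
    constructor
    · intro h3
      exact ⟨h1, by omega, h3⟩
    · exact fun h3 => h3.2.2
  have hcount : ∀ i, 1 ≤ i → i < n → Multiset.count i ρ + Invi n (fun x => w x) i
      = Invi n (fun x => w x) (i + 1) + if i = a ∨ i = b then n - i else 0 := by
    intro i h1 h2
    have hlt : Multiset.count i ρ < n - i := by
      by_contra hc
      apply hirr i h1 (by omega)
      rw [kRect, ← Multiset.le_count_iff_replicate_le]
      omega
    have hm := hmod i
    rw [aux_count n w hwout i h1 h2] at hm
    have hs := aux_zeta_step n w hwout i h1 h2
    have hb1 := aux_Invi_le n (fun x => w x) i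
    have hb2 := aux_Invi_le n (fun x => w x) (i + 1)
    have hd := hdes i h1 h2
    split_ifs with hi
    · have h3 := aux_Invi_desc n (fun x => w x) i h2 (hd.2 hi)
      have h4 := Nat.ModEq.eq_of_lt_of_lt hm (by omega) hlt
      omega
    · have hne : w (i + 1) ≠ w i := by
        intro h
        have := w.injective h
        omega
      have hlt2 : w i < w (i + 1) := by
        have := mt hd.1 hi
        omega
      have h3 := aux_Invi_asc n (fun x => w x) i hlt2
      have h4 : zeta n (fun x => w x) i - zeta n (fun x => w x) (i + 1)
          = (Invi n (fun x => w x) (i + 1) - Invi n (fun x => w x) i) + (n - i) := by omega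
      rw [h4] at hm
      have h5 := Nat.ModEq.eq_of_lt_of_lt (Nat.add_modEq_right.symm.trans hm) (by omega) hlt
      omega
  have hbig : ∀ i, n ≤ i → mT ρ i = 0 := by
    intro i hi
    unfold mT
    rw [Multiset.card_eq_zero, Multiset.filter_eq_nil]
    intro x hx
    have := aux_mem_lt n _ (by omega) x (Multiset.mem_of_le hle hx)
    omega
  have main : ∀ d i, 1 ≤ i → i + d = n → mT ρ i + Invi n (fun x => w x) i
      = (if i ≤ a then n - a else 0) + (if i ≤ b then n - b else 0) := by
    intro d
    induction d with
    | zero =>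
      intro i h1 h2
      rw [hbig i (by omega), if_neg (by omega), if_neg (by omega)]
      have := aux_Invi_le n (fun x => w x) i
      omega
    | succ d ih =>
      intro i h1 h2
      have h3 := ih (i + 1) (by omega) (by omega)
      have h4 := hcount i h1 (by omega)
      have h5 := aux_mT ρ i
      split_ifs at h3 h4 ⊢ <;> omega
  refine ⟨?_, ?_, ?_⟩
  · intro i h1 h2
    have := main (n - i) i h1 (by omega)
    rw [if_pos h2, if_pos (by omega)] at this
    omega
  · intro i h1 h2
    have := main (n - i) i (by omega) (by omega)
    rw [if_neg (by omega), if_pos h2] at this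
    omega
  · intro i h1
    rcases Nat.lt_or_ge i n with h | h
    · have := main (n - i) i (by omega) (by omega)
      rw [if_neg (by omega), if_neg (by omega)] at this
      omega
    · exact hbig i h
end

section
/- Fix positive integers m, r with n = m + r. Let ν = (ν_1, …, ν_m) ⊆ R_r, let δ = diag_0(ν^{∨_r}), fix an integer d with 0 ≤ d ≤ δ, and set a_d = #{i ∈ [m] : ν_i ≥ r − d} and t = diag_0((ν⊕d)^{∨_r}). Then the split ν ⊕ d = (η_t^1, η_t^2) is given explicitly by η_t^1 = (r^{d+a_d}, ν_{a_d+1}+d, …, ν_{m−δ}+d) and η_t^2 = (ν_{m−δ+1}+d, …, ν_m+d, ν_1+d−r, …, ν_{a_d}+d−r). -/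
/-- The cells of the skew shape `lam/μ` (French notation, rows indexed from 1). -/
def skewCells (μ lam : ℕ → ℕ) : Set (ℕ × ℕ) :=
  {c | 1 ≤ c.1 ∧ μ c.1 < c.2 ∧ c.2 ≤ lam c.1}

/-- Two cells share a full edge. -/
def AdjCell (a b : ℕ × ℕ) : Prop :=
  (a.1 = b.1 ∧ (a.2 + 1 = b.2 ∨ b.2 + 1 = a.2)) ∨
  (a.2 = b.2 ∧ (a.1 + 1 = b.1 ∨ b.1 + 1 = a.1))

/-- A set of cells is connected via shared edges. -/
def ConnectedCells (S : Set (ℕ × ℕ)) : Prop :=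
  ∀ x ∈ S, ∀ y ∈ S,
    Relation.ReflTransGen (fun a b => a ∈ S ∧ b ∈ S ∧ AdjCell a b) x y

/-- The set of cells contains no 2 × 2 square. -/
def No2x2 (S : Set (ℕ × ℕ)) : Prop :=
  ¬ ∃ i j, (i, j) ∈ S ∧ (i + 1, j) ∈ S ∧ (i, j + 1) ∈ S ∧ (i + 1, j + 1) ∈ S

/-- The head (southeasternmost cell) of the set of cells lies in column `r`. -/
def HeadInCol (S : Set (ℕ × ℕ)) (r : ℕ) : Prop :=
  ∃ i, (i, r) ∈ S ∧ ∀ c ∈ S, i ≤ c.1 ∧ c.2 ≤ r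

/-- A partition, as a weakly decreasing, eventually zero function on rows `1, 2, …`. -/
def IsPartitionFun (lam : ℕ → ℕ) : Prop :=
  (∀ i, 1 ≤ i → lam (i + 1) ≤ lam i) ∧ ∃ N, ∀ i, N ≤ i → lam i = 0

/-- `lam` is obtained from `μ` by adding one `n`-rim hook whose head lies in column `r`. -/
def AddRimHook (n r : ℕ) (μ lam : ℕ → ℕ) : Prop :=
  IsPartitionFun lam ∧ (∀ i, μ i ≤ lam i) ∧
  (skewCells μ lam).ncard = n ∧
  ConnectedCells (skewCells μ lam) ∧
  No2x2 (skewCells μ lam) ∧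
  HeadInCol (skewCells μ lam) r

/-- `μ = ν ⊕ d`: `μ` is obtained from `ν` by successively adding `d` different
`n`-rim hooks so that all `d` heads lie in column `r`. -/
def OplusChain (n r d : ℕ) (ν μ : ℕ → ℕ) : Prop :=
  ∃ f : ℕ → ℕ → ℕ, f 0 = ν ∧ f d = μ ∧ ∀ i, i < d → AddRimHook n r (f i) (f (i + 1))

/-- The transpose of a partition whose parts are indexed `1, …, rows`:
`(transposeFn rows lam) i = #{p ∈ [1,rows] : lam p ≥ i}`. -/
def transposeFn (rows : ℕ) (lam : ℕ → ℕ) (i : ℕ) : ℕ :=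
  ((Finset.Icc 1 rows).filter (fun p => i ≤ lam p)).card

/-- The complement of a partition inside the rectangle with `rows` rows and
`cols` columns. -/
def complRect (rows cols : ℕ) (lam : ℕ → ℕ) : ℕ → ℕ :=
  fun i => if 1 ≤ i ∧ i ≤ rows then cols - lam (rows + 1 - i) else 0

/-- `diag_0(lam) = #{i : lam_i ≥ i}`, the number of diagonal cells `(i,i)` of `lam`
(counted for `i ≤ B`, where `B` is any sufficiently large bound). -/
def diag0 (B : ℕ) (lam : ℕ → ℕ) : ℕ :=
  ((Finset.Icc 1 B).filter (fun i => i ≤ lam i)).card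

theorem anti_of_step {f : ℕ → ℕ} (h : ∀ i, 1 ≤ i → f (i + 1) ≤ f i) :
    ∀ i j, 1 ≤ i → i ≤ j → f j ≤ f i := by
  intro i j hi hij
  induction j, hij using Nat.le_induction with
  | base => exact le_rfl
  | succ k hk ih => exact (h k (by omega)).trans ih

theorem le_card_iff (M : ℕ) (P : ℕ → Prop) [DecidablePred P]
    (h : ∀ i j, 1 ≤ i → i ≤ j → j ≤ M → P j → P i) (j : ℕ) (h1 : 1 ≤ j) (hM : j ≤ M) :
    j ≤ ((Finset.Icc 1 M).filter P).card ↔ P j := by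
  constructor
  · intro hj
    by_contra hP
    have : (Finset.Icc 1 M).filter P ⊆ Finset.Icc 1 (j - 1) := by
      intro x hx
      simp only [Finset.mem_filter, Finset.mem_Icc] at hx ⊢
      refine ⟨hx.1.1, ?_⟩
      by_contra hlt
      exact hP (h j x h1 (by omega) hx.1.2 hx.2)
    have := Finset.card_le_card this
    simp only [Nat.card_Icc] at this
    omega
  · intro hP
    have : Finset.Icc 1 j ⊆ (Finset.Icc 1 M).filter P := by
      intro x hx
      simp only [Finset.mem_filter, Finset.mem_Icc] at hx ⊢
      exact ⟨⟨hx.1, by omega⟩, h x j hx.1 hx.2 hM hP⟩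
    have := Finset.card_le_card this
    simp only [Nat.card_Icc] at this
    omega

theorem card_filter_le (M : ℕ) (P : ℕ → Prop) [DecidablePred P] :
    ((Finset.Icc 1 M).filter P).card ≤ M := by
  have := Finset.card_filter_le (Finset.Icc 1 M) P
  simpa using this

theorem crossing {S : Set (ℕ × ℕ)} (hS : ConnectedCells S) (j : ℕ) (x y : ℕ × ℕ)
    (hx : x ∈ S) (hy : y ∈ S) (hxj : x.1 ≤ j) (hyj : j < y.1) :
    ∃ c, (j, c) ∈ S ∧ (j + 1, c) ∈ S := by
  by_contra hno
  have key : ∀ z, Relation.ReflTransGen (fun a b => a ∈ S ∧ b ∈ S ∧ AdjCell a b) x z →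
      z.1 ≤ j := by
    intro z hz
    induction hz with
    | refl => exact hxj
    | @tail b c _ hbc ih =>
      obtain ⟨hb, hc, hadj⟩ := hbc
      by_contra hlt
      apply hno
      obtain ⟨b1, b2⟩ := b
      obtain ⟨c1, c2⟩ := c
      simp only [AdjCell] at *
      have e1 : b1 = j := by omega
      have e2 : c1 = j + 1 := by omega
      have e3 : b2 = c2 := by omega
      subst e1 e2 e3
      exact ⟨b2, hb, hc⟩
  have := key y (hS x hx y hy)
  omega

theorem rim_structure (n r : ℕ) (hn0 : 0 < n) (μ lam : ℕ → ℕ)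
    (hμ : ∀ i j, 1 ≤ i → i ≤ j → μ j ≤ μ i) (h : AddRimHook n r μ lam) :
    ∃ i k, 1 ≤ i ∧ i ≤ k ∧ lam i = r ∧ μ i < r ∧ μ k < r ∧
      (∀ j, 1 ≤ j → j < i → lam j = μ j ∧ r ≤ μ j) ∧
      (∀ j, k < j → lam j = μ j) ∧
      (∀ j, i ≤ j → j < k → lam (j + 1) = μ j + 1) ∧
      r - μ k + (k - i) = n := by
  obtain ⟨⟨hl, N, hN⟩, hle, hcard, hconn, hno, i, hir, hhead⟩ := h
  have hl' := anti_of_step hl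
  have hmem : ∀ a b, (a, b) ∈ skewCells μ lam ↔ 1 ≤ a ∧ μ a < b ∧ b ≤ lam a := by
    intro a b; rfl
  have hrow : ∀ j, 1 ≤ j → μ j < lam j → (j, lam j) ∈ skewCells μ lam := by
    intro j h1 h2
    exact (hmem _ _).2 ⟨h1, h2, le_rfl⟩
  obtain ⟨hi1, hi2, hi3⟩ := (hmem _ _).1 hir
  have hlami : lam i = r := by
    have := (hhead _ (hrow i hi1 (by omega))).2
    simp only at this
    omega
  -- last row
  let Q : ℕ → Prop := fun j => μ j < lam j
  have hQ : ∃ k, i ≤ k ∧ μ k < lam k ∧ ∀ j, k < j → ¬ μ j < lam j := by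
    classical
    have hiN : i ≤ N := by
      by_contra hc
      have := hN i (by omega)
      omega
    have hQi : Q i := by show μ i < lam i; omega
    refine ⟨Nat.findGreatest Q N, Nat.le_findGreatest hiN hQi, ?_, ?_⟩
    · exact Nat.findGreatest_spec (P := Q) hiN hQi
    · intro j hj hlt
      by_cases hjN : j ≤ N
      · exact Nat.findGreatest_is_greatest hj hjN hlt
      · have := hN j (by omega)
        omega
  obtain ⟨k, hik, hk, hkmax⟩ := hQ
  have hstep : ∀ j, i ≤ j → j < k → lam (j + 1) = μ j + 1 := by
    intro j hij hjk
    obtain ⟨c, hc1, hc2⟩ := crossing hconn j (i, r) (k, lam k) hir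
      (hrow k (by omega) hk) hij hjk
    have h1 := (hmem _ _).1 hc1
    have h2 := (hmem _ _).1 hc2
    by_contra hne
    apply hno
    have h3 := hl' j (j + 1) (by omega) (by omega)
    have h4 := hμ j (j + 1) (by omega) (by omega)
    refine ⟨j, μ j + 1, ?_, ?_, ?_, ?_⟩ <;> rw [hmem] <;> omega
  have hlamk : lam k ≤ r := by
    have := hl' i k hi1 hik
    omega
  refine ⟨i, k, hi1, hik, hlami, by omega, by omega, ?_, ?_, hstep, ?_⟩
  · intro j h1 hj
    have heq : lam j = μ j := by
      by_contra hne
      have h2 := hle j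
      have := (hhead _ (hrow j h1 (by omega))).1
      simp only at this
      omega
    have := hl' j i h1 (by omega)
    omega
  · intro j hj
    have h1 := hkmax j hj
    have h2 := hle j
    omega
  · have hset : skewCells μ lam =
        ↑(((Finset.Icc i k).sigma fun j => Finset.Ioc (μ j) (lam j)).map
          (Equiv.sigmaEquivProd ℕ ℕ).toEmbedding) := by
      ext ⟨a, b⟩
      rw [hmem]
      simp only [Finset.coe_map, Set.mem_image, Finset.mem_coe, Finset.mem_sigma,
        Finset.mem_Icc, Finset.mem_Ioc, Equiv.coe_toEmbedding]
      constructor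
      · rintro ⟨h1, h2, h3⟩
        refine ⟨⟨a, b⟩, ⟨⟨?_, ?_⟩, h2, h3⟩, rfl⟩
        · exact (hhead _ ((hmem a b).2 ⟨h1, h2, h3⟩)).1
        · show a ≤ k
          by_contra hc
          exact hkmax a (by omega) (by omega)
      · rintro ⟨⟨a', b'⟩, ⟨⟨h1, h2⟩, h3, h4⟩, he⟩
        simp only [Equiv.sigmaEquivProd_apply, Prod.mk.injEq] at he
        obtain ⟨rfl, rfl⟩ := he
        exact ⟨hi1.trans h1, h3, h4⟩
    rw [hset, Set.ncard_coe_finset, Finset.card_map, Finset.card_sigma] at hcard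
    simp only [Nat.card_Ioc] at hcard
    have hsum : ∀ K, i ≤ K → K ≤ k →
        ∑ j ∈ Finset.Icc i K, (lam j - μ j) = r - μ K + (K - i) := by
      intro K hK
      induction K, hK using Nat.le_induction with
      | base => intro _; simp [hlami]
      | succ K hK ih =>
        intro hKk
        rw [Finset.sum_Icc_succ_top (by omega), ih (by omega), hstep K hK (by omega)]
        have h1 := hμ K (K + 1) (by omega) (by omega)
        have h2 := hμ i K (by omega) (by omega)
        omega
    rw [← hsum k hik le_rfl]
    exact hcard

/-- Explicit form of `ν ⊕ d`. -/
def oplusForm (m r : ℕ) (ν : ℕ → ℕ) (d i : ℕ) : ℕ :=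
  if i ≤ d then r else if i ≤ m + d then min r (ν (i - d) + d) else ν (i - m - d) + d - r

theorem oplus_step (m r : ℕ) (hm : 0 < m) (ν : ℕ → ℕ)
    (hν : ∀ i j, 1 ≤ i → i ≤ j → ν j ≤ ν i)
    (hzero : ∀ i, m < i → ν i = 0) (hbd : ν 1 ≤ r) (d : ℕ) (hd : d < r)
    (μ lam : ℕ → ℕ) (hμ : ∀ i j, 1 ≤ i → i ≤ j → μ j ≤ μ i)
    (hform : ∀ j, 1 ≤ j → μ j = oplusForm m r ν d j)
    (h : AddRimHook (m + r) r μ lam) :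
    ∀ j, 1 ≤ j → lam j = oplusForm m r ν (d + 1) j := by
  obtain ⟨i, k, hi1, hik, hlami, hμi, hμk, hlow, hhigh, hstep, hsize⟩ :=
    rim_structure (m + r) r (by omega) μ lam hμ h
  have hble : ∀ j, 1 ≤ j → ν j ≤ r := fun j hj => (hν 1 j le_rfl hj).trans hbd
  obtain ⟨a, ham, ha⟩ : ∃ a ≤ m, ∀ j, 1 ≤ j → (j ≤ a ↔ r ≤ ν j + d) := by
    refine ⟨_, card_filter_le m (fun j => r ≤ ν j + d), ?_⟩
    intro j hj
    by_cases hjm : j ≤ m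
    · apply le_card_iff m _ _ j hj hjm
      intro x y hx hxy _ hP
      have := hν x y hx hxy
      omega
    · have h1 := card_filter_le m (fun j => r ≤ ν j + d)
      have h2 := hzero j (by omega)
      constructor
      · intro h3; omega
      · intro h3; omega
  have hchar : ∀ j, 1 ≤ j → (r ≤ μ j ↔ j ≤ d + a) := by
    intro j hj
    rw [hform j hj]
    unfold oplusForm
    split_ifs with h1 h2
    · simp; omega
    · have := ha (j - d) (by omega)
      rw [le_min_iff]
      omega
    · have := hble (j - m - d) (by omega)
      omega
  have hi : i = d + a + 1 := by
    have h1 := hchar i hi1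
    by_contra hne
    have h2 := hchar (d + a + 1) (by omega)
    have h3 := hlow (d + a + 1) (by omega)
    omega
  have hk0 : μ k = 0 := by
    rw [hform k (by omega)]
    unfold oplusForm
    rw [if_neg (by omega), if_neg (by omega)]
    have := ha (k - m - d) (by omega)
    omega
  have hk : k = m + d + a + 1 := by omega
  intro j hj
  unfold oplusForm
  rcases lt_trichotomy j i with hji | hji | hji
  · have h1 := hlow j hj hji
    have h2 := hform j hj
    have h3 := ha (j - (d + 1))
    split_ifs with c1 c2
    · unfold oplusForm at h2
      by_cases hjd : j ≤ d
      · rw [if_pos hjd] at h2; omega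
      · rw [if_neg hjd, if_pos (by omega)] at h2
        have := min_le_left r (ν (j - d) + d)
        omega
    · rw [min_eq_left (by omega)]
      unfold oplusForm at h2
      rw [if_neg (by omega), if_pos (by omega)] at h2
      have := min_le_left r (ν (j - d) + d)
      omega
    · omega
  · rw [hji, hlami]
    split_ifs with c1 c2
    · rfl
    · have := ha (i - (d + 1)) (by omega)
      rw [min_eq_left (by omega)]
    · omega
  · rw [if_neg (by omega)]
    by_cases hjk : j ≤ k
    · have h1 := hstep (j - 1) (by omega) (by omega)
      rw [show j - 1 + 1 = j by omega, hform (j - 1) (by omega)] at h1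
      unfold oplusForm at h1
      rw [if_neg (by omega)] at h1
      split_ifs with c1
      · rw [if_pos (by omega), show j - 1 - d = j - (d + 1) by omega] at h1
        have := ha (j - (d + 1)) (by omega)
        omega
      · rw [if_neg (by omega), show j - 1 - m - d = j - m - (d + 1) by omega] at h1
        have := ha (j - m - (d + 1)) (by omega)
        omega
    · rw [if_neg (by omega), hhigh j (by omega), hform j hj]
      unfold oplusForm
      rw [if_neg (by omega), if_neg (by omega)]
      have h1 := ha (j - m - (d + 1)) (by omega)
      have h2 := ha (j - m - d) (by omega)
      omega

theorem le_diag_iff (m r : ℕ) (f : ℕ → ℕ) (hf : ∀ i j, 1 ≤ i → i ≤ j → f j ≤ f i)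
    (j : ℕ) (hj : 1 ≤ j) :
    j ≤ diag0 (m + r) (complRect m r f) ↔ j ≤ m ∧ j + f (m + 1 - j) ≤ r := by
  have hmem : ∀ j, 1 ≤ j → (j ≤ complRect m r f j ↔ j ≤ m ∧ j + f (m + 1 - j) ≤ r) := by
    intro j hj
    unfold complRect
    split_ifs with h <;> omega
  by_cases hjn : j ≤ m + r
  · rw [← hmem j hj]
    apply le_card_iff (m + r) (fun i => i ≤ complRect m r f i) _ j hj hjn
    intro x y hx hxy _ hP
    rw [hmem y (by omega)] at hP
    rw [hmem x hx]
    have := hf (m + 1 - y) (m + 1 - x) (by omega) (by omega)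
    omega
  · have h1 : diag0 (m + r) (complRect m r f) ≤ m + r := card_filter_le _ _
    omega

/-- Lemma (lem:nuoplusd), second part: the split `ν ⊕ d = (η_t^1, η_t^2)` at
`t = diag_0((ν⊕d)^{∨_r})` is given by `η_t^1 = (r^{d+a_d}, ν_{a_d+1}+d, …, ν_{m−δ}+d)`
and `η_t^2 = (ν_{m−δ+1}+d, …, ν_m+d, ν_1+d−r, …, ν_{a_d}+d−r)`, where
`δ = diag_0(ν^{∨_r})` and `a_d = #{i ∈ [m] : ν_i ≥ r−d}`. -/
theorem stmt9 (m r n : ℕ) (hm : 0 < m) (hr : 0 < r) (hn : n = m + r)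
    (ν : ℕ → ℕ)
    (hmono : ∀ i, 1 ≤ i → ν (i + 1) ≤ ν i)
    (hzero : ∀ i, m < i → ν i = 0)
    (hbd : ν 1 ≤ r)
    (d : ℕ) (hd : d ≤ diag0 n (complRect m r ν)) :
    ∀ μ, OplusChain n r d ν μ →
      ∀ δ aD t,
        δ = diag0 n (complRect m r ν) →
        aD = ((Finset.Icc 1 m).filter (fun i => r - d ≤ ν i)).card →
        t = diag0 n (complRect m r μ) →
        (∀ i, 1 ≤ i → i ≤ m - t →
          μ i = if i ≤ d + aD then r else ν (i - d) + d) ∧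
        (∀ i, 1 ≤ i →
          μ (m - t + i) = if i ≤ δ then ν (m - δ + i) + d
                          else if i ≤ δ + aD then ν (i - δ) + d - r
                          else 0) := by
  subst hn
  have hν := anti_of_step hmono
  have hble : ∀ j, 1 ≤ j → ν j ≤ r := fun j hj => (hν 1 j le_rfl hj).trans hbd
  intro μ hchain δ aD t hδ haD ht
  rw [← hδ] at hd
  have hδi := le_diag_iff m r ν hν
  rw [← hδ] at hδi
  have hdr : d ≤ r := by
    by_contra hc
    have := hδi δ (by omega)
    omega
  have hδm : δ ≤ m := by
    by_contra hc
    have := hδi δ (by omega)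
    omega
  obtain ⟨f, hf0, hfd, hf⟩ := hchain
  have hind : ∀ e, e ≤ d → (∀ i j, 1 ≤ i → i ≤ j → f e j ≤ f e i) ∧
      ∀ j, 1 ≤ j → f e j = oplusForm m r ν e j := by
    intro e
    induction e with
    | zero =>
      intro _
      rw [hf0]
      refine ⟨hν, ?_⟩
      intro j hj
      unfold oplusForm
      rw [if_neg (by omega)]
      have h1 := hble j hj
      split_ifs with c
      · simp [h1]
      · have := hble (j - m - 0) (by omega)
        have := hzero j (by omega)
        omega
    | succ e ih =>
      intro he
      obtain ⟨ih1, ih2⟩ := ih (by omega)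
      have hA := hf e (by omega)
      exact ⟨anti_of_step hA.1.1,
        oplus_step m r hm ν hν hzero hbd e (by omega) (f e) (f (e + 1)) ih1 ih2 hA⟩
  obtain ⟨hμ, hform⟩ := hind d le_rfl
  rw [hfd] at hμ hform
  have haDm : aD ≤ m := by rw [haD]; exact card_filter_le _ _
  have ha : ∀ j, 1 ≤ j → j ≤ m → (j ≤ aD ↔ r ≤ ν j + d) := by
    intro j hj hjm
    rw [haD, le_card_iff m (fun i => r - d ≤ ν i) _ j hj hjm]
    · omega
    · intro x y hx hxy _ hP
      have := hν x y hx hxy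
      omega
  have hti := le_diag_iff m r μ hμ
  rw [← ht] at hti
  have hA : ∀ j, 1 ≤ j → j ≤ d → μ j = r := by
    intro j hj h1
    rw [hform j hj]; unfold oplusForm
    rw [if_pos h1]
  have hB : ∀ j, d < j → j ≤ m + d → j - d ≤ aD → μ j = r := by
    intro j hj h1 h2
    rw [hform j (by omega)]; unfold oplusForm
    have := ha (j - d) (by omega) (by omega)
    rw [if_neg (by omega), if_pos h1, min_eq_left (by omega)]
  have hC : ∀ j, d < j → j ≤ m + d → aD < j - d → μ j = ν (j - d) + d ∧ μ j < r := by
    intro j hj h1 h2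
    rw [hform j (by omega)]; unfold oplusForm
    have := ha (j - d) (by omega) (by omega)
    rw [if_neg (by omega), if_pos h1, min_eq_right (by omega)]
    omega
  have hD : ∀ j, m + d < j → μ j = ν (j - m - d) + d - r := by
    intro j hj
    rw [hform j (by omega)]; unfold oplusForm
    rw [if_neg (by omega), if_neg (by omega)]
  have htd : t = δ - d := by
    have up : ∀ j, 1 ≤ j → (j ≤ t ↔ j ≤ δ - d) := by
      intro j hj
      rw [hti j hj]
      constructor
      · rintro ⟨h1, h2⟩
        by_contra hc
        have h3 := hδi (j + d) (by omega)
        by_cases c1 : m + 1 - j ≤ d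
        · have := hA (m + 1 - j) (by omega) c1
          omega
        · by_cases c2 : m + 1 - j - d ≤ aD
          · have := hB (m + 1 - j) (by omega) (by omega) c2
            omega
          · have := hC (m + 1 - j) (by omega) (by omega) (by omega)
            rw [show m + 1 - j - d = m + 1 - (j + d) by omega] at this
            omega
      · intro h1
        have h3 := (hδi (j + d) (by omega)).1 (by omega)
        have h4 := ha (m + 1 - (j + d)) (by omega) (by omega)
        have h5 := hC (m + 1 - j) (by omega) (by omega) (by omega)
        rw [show m + 1 - j - d = m + 1 - (j + d) by omega] at h5
        omega
    have h1 := up t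
    have h2 := up (δ - d)
    omega
  constructor
  · intro i hi him
    split_ifs with c
    · by_cases c1 : i ≤ d
      · exact hA i hi c1
      · exact hB i (by omega) (by omega) (by omega)
    · exact (hC i (by omega) (by omega) (by omega)).1
  · intro i hi
    have hidx : m - t + i = m - δ + d + i := by omega
    rw [hidx]
    split_ifs with c1 c2
    · have e : m - δ + d + i - d = m - δ + i := by omega
      by_cases c3 : m - δ + i ≤ aD
      · rw [hB _ (by omega) (by omega) (by omega)]
        have h1 := ha (m - δ + i) (by omega) (by omega)
        have h2 := (hδi δ (by omega)).1 le_rfl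
        have h3 := hν (m + 1 - δ) (m - δ + i) (by omega) (by omega)
        omega
      · rw [(hC _ (by omega) (by omega) (by omega)).1, e]
    · rw [hD _ (by omega), show m - δ + d + i - m - d = i - δ by omega]
    · rw [hD _ (by omega), show m - δ + d + i - m - d = i - δ by omega]
      by_cases c3 : i - δ ≤ m
      · have := ha (i - δ) (by omega) c3
        omega
      · have := hzero (i - δ) (by omega)
        omega
end

section
/- Fix positive integers m, r with n = m + r. Let ν = (ν_1, …, ν_m) ⊆ R_r, let δ = diag_0(ν^{∨_r}), and let ρ = φ^r(ν) be the partition whose bit string is obtained by cycling the first r bits of b_ν to the end. Then ρ = (ν_{m−δ+1}+δ, …, ν_m+δ, ν_1−r+δ, …, ν_{m−δ}−r+δ), and moreover diag_0(ρ) = δ. -/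
/-- Position `p ∈ [1,n]` of the bit string of the partition `lam ⊆ R_r = (r^m)` is a `0`
(a vertical step of the boundary path): this happens exactly when
`p = lam_i + (m−i) + 1` for some row `i ∈ [1,m]`. -/
def ZeroAt (m : ℕ) (lam : ℕ → ℕ) (p : ℕ) : Prop :=
  ∃ i, 1 ≤ i ∧ i ≤ m ∧ p = lam i + (m - i) + 1

theorem aux_count_s10 (B : ℕ) (P : ℕ → Prop) [DecidablePred P]
    (hP : ∀ i j, 1 ≤ i → i ≤ j → P j → P i) (j : ℕ) (h1 : 1 ≤ j) (hB : j ≤ B) :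
    P j ↔ j ≤ ((Finset.Icc 1 B).filter P).card := by
  constructor
  · intro h
    have hs : Finset.Icc 1 j ⊆ (Finset.Icc 1 B).filter P := by
      intro x hx
      simp only [Finset.mem_Icc, Finset.mem_filter] at hx ⊢
      exact ⟨⟨hx.1, by omega⟩, hP x j hx.1 hx.2 h⟩
    have := Finset.card_le_card hs
    simpa using this
  · intro h
    by_contra hn
    have hs : (Finset.Icc 1 B).filter P ⊆ Finset.Icc 1 (j - 1) := by
      intro x hx
      simp only [Finset.mem_Icc, Finset.mem_filter] at hx ⊢
      refine ⟨hx.1.1, ?_⟩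
      by_contra hlt
      exact hn (hP j x h1 (by omega) hx.2)
    have := Finset.card_le_card hs
    simp at this
    omega

theorem aux_anti_s10 (f : ℕ → ℕ) (h : ∀ i, 1 ≤ i → f (i + 1) ≤ f i) (i j : ℕ) (hi : 1 ≤ i)
    (hij : i ≤ j) : f j ≤ f i := by
  induction j, hij using Nat.le_induction with
  | base => exact le_rfl
  | succ k hk ih => exact (h k (by omega)).trans ih

theorem aux_unique (m : ℕ) (a b : ℕ → ℕ)
    (ha : ∀ i j, 1 ≤ i → i < j → j ≤ m → a j < a i)
    (hb : ∀ i j, 1 ≤ i → i < j → j ≤ m → b j < b i)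
    (hab : ∀ i, 1 ≤ i → i ≤ m → ∃ j, 1 ≤ j ∧ j ≤ m ∧ a i = b j)
    (hba : ∀ i, 1 ≤ i → i ≤ m → ∃ j, 1 ≤ j ∧ j ≤ m ∧ b i = a j) :
    ∀ k, 1 ≤ k → k ≤ m → a k = b k := by
  intro k
  induction k using Nat.strong_induction_on with
  | _ k ih =>
    intro h1 h2
    apply le_antisymm
    · obtain ⟨j, hj1, hj2, hj⟩ := hab k h1 h2
      rcases lt_trichotomy j k with h | h | h
      · have := ih j h hj1 hj2
        have := ha j k hj1 h h2
        omega
      · subst h; omega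
      · have := hb k j h1 h hj2
        omega
    · obtain ⟨j, hj1, hj2, hj⟩ := hba k h1 h2
      rcases lt_trichotomy j k with h | h | h
      · have := ih j h hj1 hj2
        have := hb j k hj1 h h2
        omega
      · subst h; omega
      · have := ha k j h1 h hj2
        omega

/-- Lemma (le:nicerho): the cycled partition `ρ = φ^r(ν)` is given explicitly by
`ρ = (ν_{m−δ+1}+δ, …, ν_m+δ, ν_1−r+δ, …, ν_{m−δ}−r+δ)` where `δ = diag_0(ν^{∨_r})`,
and moreover `diag_0(ρ) = δ`.  Here `ρ = φ^r(ν)` is expressed by saying that the bit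
string of `ρ` is the bit string of `ν` with its first `r` bits cycled to the end. -/
theorem stmt10 (m r n : ℕ) (hm : 0 < m) (hr : 0 < r) (hn : n = m + r)
    (ν : ℕ → ℕ)
    (hνmono : ∀ i, 1 ≤ i → ν (i + 1) ≤ ν i)
    (hνzero : ∀ i, m < i → ν i = 0)
    (hνbd : ν 1 ≤ r)
    (ρ : ℕ → ℕ)
    (hρmono : ∀ i, 1 ≤ i → ρ (i + 1) ≤ ρ i)
    (hρzero : ∀ i, m < i → ρ i = 0)
    (hρbd : ρ 1 ≤ r)
    (hcyc : ∀ p, 1 ≤ p → p ≤ n →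
      (ZeroAt m ρ p ↔ ((p ≤ m ∧ ZeroAt m ν (p + r)) ∨ (m < p ∧ ZeroAt m ν (p - m))))) :
    ∀ δ, δ = diag0 n (complRect m r ν) →
      (∀ i, 1 ≤ i → i ≤ δ → ρ i = ν (m - δ + i) + δ) ∧
      (∀ i, δ < i → i ≤ m → ρ i = ν (i - δ) + δ - r) ∧
      diag0 n ρ = δ := by
  intro δ hδ
  have hν := aux_anti_s10 ν hνmono
  have hρ := aux_anti_s10 ρ hρmono
  have hc : ∀ j, 1 ≤ j → j ≤ n → (j ≤ complRect m r ν j ↔ j ≤ δ) := by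
    intro j h1 h2
    rw [hδ]
    unfold diag0
    refine aux_count_s10 n (fun i => i ≤ complRect m r ν i) ?_ j h1 h2
    intro i k hi hik hk
    simp only [complRect] at hk ⊢
    split_ifs at hk with hkm
    · rw [if_pos ⟨hi, by omega⟩]
      have := hν (m + 1 - k) (m + 1 - i) (by omega) (by omega)
      omega
    · omega
  have hδm : δ ≤ m := by
    by_contra hlt
    have := (hc (m + 1) (by omega) (by omega)).2 (by omega)
    simp [complRect] at this
  -- rows of `ν` whose vertical step lies among the first `r` bits
  have hrow : ∀ i, 1 ≤ i → i ≤ m → (ν i + (m - i) + 1 ≤ r ↔ m - δ < i) := by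
    intro i h1 h2
    have h := hc (m + 1 - i) (by omega) (by omega)
    simp only [complRect] at h
    rw [if_pos ⟨by omega, by omega⟩, show m + 1 - (m + 1 - i) = i by omega] at h
    omega
  have hνr : ∀ i, 1 ≤ i → ν i ≤ r := fun i hi => (hν 1 i le_rfl hi).trans hνbd
  have hρr : ∀ i, 1 ≤ i → ρ i ≤ r := fun i hi => (hρ 1 i le_rfl hi).trans hρbd
  have key := aux_unique m (fun i => ρ i + (m - i) + 1)
    (fun i => if i ≤ δ then ν (m - δ + i) + (δ - i) + 1 + m
      else ν (i - δ) + (m - (i - δ)) + 1 - r)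
    (by
      intro i j h1 h2 h3
      have := hρ i j h1 h2.le
      omega)
    (by
      intro i j h1 h2 h3
      split_ifs with hj hi hi
      · have := hν (m - δ + i) (m - δ + j) (by omega) (by omega)
        omega
      · omega
      · have := hνr (j - δ) (by omega)
        omega
      · have := hν (i - δ) (j - δ) (by omega) (by omega)
        have := hrow (j - δ) (by omega) (by omega)
        omega)
    (by
      intro i h1 h2
      have hb := hρr i h1
      rcases (hcyc (ρ i + (m - i) + 1) (by omega) (by omega)).1 ⟨i, h1, h2, rfl⟩ with
        ⟨hp, k, hk1, hk2, hk⟩ | ⟨hp, k, hk1, hk2, hk⟩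
      · have := hrow k hk1 hk2
        refine ⟨k + δ, by omega, by omega, ?_⟩
        rw [if_neg (by omega), show k + δ - δ = k by omega]
        omega
      · have := hrow k hk1 hk2
        refine ⟨k - (m - δ), by omega, by omega, ?_⟩
        rw [if_pos (by omega), show m - δ + (k - (m - δ)) = k by omega]
        omega)
    (by
      intro i h1 h2
      split_ifs with hi
      · have := hrow (m - δ + i) (by omega) (by omega)
        obtain ⟨k, hk1, hk2, hk⟩ := (hcyc (ν (m - δ + i) + (δ - i) + 1 + m) (by omega)
          (by omega)).2 (Or.inr ⟨by omega, m - δ + i, by omega, by omega, by omega⟩)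
        exact ⟨k, hk1, hk2, hk⟩
      · have := hrow (i - δ) (by omega) (by omega)
        have := hνr (i - δ) (by omega)
        obtain ⟨k, hk1, hk2, hk⟩ := (hcyc (ν (i - δ) + (m - (i - δ)) + 1 - r) (by omega)
          (by omega)).2 (Or.inl ⟨by omega, i - δ, by omega, by omega, by omega⟩)
        exact ⟨k, hk1, hk2, hk⟩)
  have hA : ∀ i, 1 ≤ i → i ≤ δ → ρ i = ν (m - δ + i) + δ := by
    intro i h1 h2
    have := key i h1 (by omega)
    rw [if_pos h2] at this
    omega
  have hB : ∀ i, δ < i → i ≤ m → ρ i = ν (i - δ) + δ - r := by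
    intro i h1 h2
    have := key i (by omega) h2
    rw [if_neg (by omega)] at this
    omega
  refine ⟨hA, hB, ?_⟩
  have hs : (Finset.Icc 1 n).filter (fun i => i ≤ ρ i) = Finset.Icc 1 δ := by
    ext i
    simp only [Finset.mem_Icc, Finset.mem_filter]
    constructor
    · rintro ⟨⟨h1, h2⟩, h3⟩
      refine ⟨h1, ?_⟩
      by_contra hlt
      by_cases him : i ≤ m
      · have := hB i (by omega) him
        have := hνr (i - δ) (by omega)
        omega
      · have := hρzero i (by omega)
        omega
    · rintro ⟨h1, h2⟩
      have := hA i h1 h2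
      omega
  unfold diag0
  rw [hs]
  simp
end

section
/- Fix positive integers m, r with n = m + r. Let ν ⊆ R_r, let δ = diag_0(ν^{∨_r}), and fix an integer d with 0 ≤ d ≤ δ. Then diag_0((ν⊕d)^{∨_r}) = δ − d. -/
theorem anti_of_step_s11 (μ : ℕ → ℕ) (h : ∀ i, 1 ≤ i → μ (i + 1) ≤ μ i) (a b : ℕ)
    (ha : 1 ≤ a) (hab : a ≤ b) : μ b ≤ μ a := by
  induction b, hab using Nat.le_induction with
  | base => exact le_rfl
  | succ k hk ih => exact (h k (ha.trans hk)).trans ih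

theorem mem_diag (m r n : ℕ) (hn : n = m + r) (μ : ℕ → ℕ) (i : ℕ) :
    i ∈ (Finset.Icc 1 n).filter (fun i => i ≤ complRect m r μ i) ↔
      1 ≤ i ∧ i ≤ m ∧ i + μ (m + 1 - i) ≤ r := by
  rw [Finset.mem_filter, Finset.mem_Icc]
  unfold complRect
  split_ifs with h <;> omega

/-- Cells of a skew shape without a 2 × 2 square have distinct contents. -/
theorem content_inj (μ lam : ℕ → ℕ) (hμ : ∀ i, 1 ≤ i → μ (i + 1) ≤ μ i)
    (hl : ∀ i, 1 ≤ i → lam (i + 1) ≤ lam i) (h2 : No2x2 (skewCells μ lam))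
    (a b : ℕ × ℕ) (ha : a ∈ skewCells μ lam) (hb : b ∈ skewCells μ lam)
    (hab : a.2 + b.1 = b.2 + a.1) : a.1 ≤ b.1 → a = b := by
  intro hle
  obtain ⟨p, c⟩ := a
  obtain ⟨q, e⟩ := b
  simp only [skewCells, Set.mem_ofPred_eq] at ha hb hab hle
  rcases Nat.eq_or_lt_of_le hle with h | h
  · subst h
    have : c = e := by omega
    rw [this]
  · exfalso
    apply h2
    have h1 := anti_of_step_s11 lam hl (p + 1) q (by omega) h
    have h3 := hμ p ha.1
    have h4 := hl p ha.1
    refine ⟨p, c, ?_, ?_, ?_, ?_⟩ <;> simp only [skewCells, Set.mem_ofPred_eq] <;> omega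

theorem exists_cell (m r n : ℕ) (hm : 0 < m) (hr : 0 < r) (hn : n = m + r) (μ lam : ℕ → ℕ)
    (hμ : ∀ i, 1 ≤ i → μ (i + 1) ≤ μ i) (h : AddRimHook n r μ lam) (hc : μ m < r) :
    ∃ c ∈ skewCells μ lam, c.1 + r = c.2 + m := by
  obtain ⟨⟨hl, -⟩, hsub, hcard, hconn, h2, i, hi, hhead⟩ := h
  have hi' := hi
  simp only [skewCells, Set.mem_ofPred_eq] at hi'
  have him : i ≤ m := by
    by_contra hlt
    have h1 := anti_of_step_s11 lam hl m i hm (by omega)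
    have := (hhead (m, r) (by simp only [skewCells, Set.mem_ofPred_eq]; omega)).1
    simp only at this
    omega
  by_contra hno
  push Not at hno
  have hpos : ∀ y ∈ skewCells μ lam, y.1 + r < y.2 + m := by
    intro y hy
    have hchain := hconn _ hi y hy
    induction hchain with
    | refl => have := hno _ hi; simp only at this ⊢; omega
    | tail _ hst ih =>
      obtain ⟨hb, hc', hadj⟩ := hst
      have h1 := ih hb
      have h3 := hno _ hc'
      unfold AdjCell at hadj
      omega
  have hle : (skewCells μ lam).ncard ≤ (↑(Finset.Ioc ((r : ℤ) - m) (r - i)) : Set ℤ).ncard := by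
    apply Set.ncard_le_ncard_of_injOn (fun c : ℕ × ℕ => (c.2 : ℤ) - c.1)
    · intro a ha
      have h1 := hpos a ha
      have h3 := hhead a ha
      simp only [Finset.coe_Ioc, Set.mem_Ioc]
      omega
    · intro a ha b hb hab
      simp only at hab
      rcases le_total a.1 b.1 with h | h
      · exact content_inj μ lam hμ hl h2 a b ha hb (by omega) h
      · exact (content_inj μ lam hμ hl h2 b a hb ha (by omega) h).symm
  rw [hcard, Set.ncard_coe_finset, Int.card_Ioc] at hle
  omega

theorem diag_step (m r n : ℕ) (hm : 0 < m) (hr : 0 < r) (hn : n = m + r) (μ lam : ℕ → ℕ)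
    (hμ : ∀ i, 1 ≤ i → μ (i + 1) ≤ μ i) (h : AddRimHook n r μ lam)
    (hd : 0 < diag0 n (complRect m r μ)) :
    diag0 n (complRect m r lam) + 1 = diag0 n (complRect m r μ) := by
  have hc : μ m < r := by
    obtain ⟨k, hk⟩ := Finset.card_pos.mp hd
    rw [mem_diag m r n hn] at hk
    have := anti_of_step_s11 μ hμ (m + 1 - k) m (by omega) (by omega)
    omega
  obtain ⟨⟨p, c⟩, hcell, hdiag⟩ := exists_cell m r n hm hr hn μ lam hμ h hc
  obtain ⟨⟨hl, -⟩, hsub, hcard, hconn, h2, i, hi, hhead⟩ := h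
  have hcr := (hhead _ hcell).2
  have hcell' := hcell
  simp only [skewCells, Set.mem_ofPred_eq] at hcell' hcr hdiag
  have hpp : m + 1 - (m + 1 - p) = p := by omega
  have hnot : m + 1 - p ∉ (Finset.Icc 1 n).filter (fun i => i ≤ complRect m r lam i) := by
    rw [mem_diag m r n hn, hpp]
    omega
  have heq : (Finset.Icc 1 n).filter (fun i => i ≤ complRect m r μ i) =
      insert (m + 1 - p) ((Finset.Icc 1 n).filter (fun i => i ≤ complRect m r lam i)) := by
    ext k
    rw [Finset.mem_insert, mem_diag m r n hn, mem_diag m r n hn]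
    constructor
    · rintro ⟨h1, h3, h4⟩
      by_cases h5 : k + lam (m + 1 - k) ≤ r
      · exact Or.inr ⟨h1, h3, h5⟩
      · left
        have hk : (m + 1 - k, r + 1 - k) ∈ skewCells μ lam := by
          simp only [skewCells, Set.mem_ofPred_eq]
          omega
        have : (m + 1 - k, r + 1 - k) = (p, c) := by
          rcases le_total (m + 1 - k) p with h | h
          · exact content_inj μ lam hμ hl h2 _ _ hk hcell (by simp only; omega) h
          · exact (content_inj μ lam hμ hl h2 _ _ hcell hk (by simp only; omega) h).symm
        have := congrArg Prod.fst this
        simp only at this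
        omega
    · rintro (rfl | ⟨h1, h3, h4⟩)
      · rw [hpp]; omega
      · have := hsub (m + 1 - k)
        omega
  unfold diag0
  rw [heq, Finset.card_insert_of_notMem hnot]

/-- Remark (re:diagdist): for `ν ⊆ R_r` and `0 ≤ d ≤ δ = diag_0(ν^{∨_r})`, one has
`diag_0((ν⊕d)^{∨_r}) = δ − d`. -/
theorem stmt11 (m r n : ℕ) (hm : 0 < m) (hr : 0 < r) (hn : n = m + r)
    (ν : ℕ → ℕ)
    (hmono : ∀ i, 1 ≤ i → ν (i + 1) ≤ ν i)
    (hzero : ∀ i, m < i → ν i = 0)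
    (hbd : ν 1 ≤ r)
    (d : ℕ) (hd : d ≤ diag0 n (complRect m r ν)) :
    ∀ μ, OplusChain n r d ν μ →
      diag0 n (complRect m r μ) = diag0 n (complRect m r ν) - d := by
  rintro μ ⟨f, hf0, hfd, hf⟩
  have key : ∀ j, j ≤ d → (∀ i, 1 ≤ i → f j (i + 1) ≤ f j i) ∧
      diag0 n (complRect m r (f j)) + j = diag0 n (complRect m r ν) := by
    intro j
    induction j with
    | zero => intro _; rw [hf0]; exact ⟨hmono, rfl⟩
    | succ k ih =>
      intro hk
      obtain ⟨h1, h2⟩ := ih (by omega)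
      have h3 := hf k (by omega)
      have h4 := diag_step m r n hm hr hn (f k) (f (k + 1)) h1 h3 (by omega)
      exact ⟨h3.1.1, by omega⟩
  have := (key d le_rfl).2
  rw [hfd] at this
  omega
end

section
/- Fix positive integers m, r with n = m + r. Let ν ⊆ R_r, let δ = diag_0(ν^{∨_r}), fix 0 ≤ d ≤ δ, set t = diag_0((ν⊕d)^{∨_r}), let ρ = φ^r(ν), and write ν ⊕ d = (η_t^1, η_t^2). Then φ_{r−t}(η_t^2) ∘ φ_{r+t}(η_t^1) = w_ρ ∘ w_0^{P'_t} ∘ w_0, where w_0(i) = n+1−i and w_0^{P'_t} ∈ S_n is defined by w_0^{P'_t}(i) = m−t+1−i for 1 ≤ i ≤ m−t, = 2m−t+1−i for m−t < i ≤ m, = 2m+t+1−i for m < i ≤ m+t, and = n+m+t+1−i for m+t < i ≤ n. -/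
/-- The longest element `w_0 ∈ S_n`, `w_0(i) = n+1−i`. -/
def w0fun (n : ℕ) : ℕ → ℕ := fun i => n + 1 - i

/-- The permutation `w_0^{P'_t} ∈ S_n`. -/
def wPfun (n m t : ℕ) : ℕ → ℕ := fun i =>
  if i ≤ m - t then m - t + 1 - i
  else if i ≤ m then 2 * m - t + 1 - i
  else if i ≤ m + t then 2 * m + t + 1 - i
  else n + m + t + 1 - i

open Classical in
/-- number of `y ∈ [1,x]` with `p y` -/
noncomputable def cnt (p : ℕ → Prop) (x : ℕ) : ℕ := ((Finset.Icc 1 x).filter p).card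

theorem cnt_zero (p : ℕ → Prop) : cnt p 0 = 0 := by simp [cnt]

theorem cnt_succ_pos (p : ℕ → Prop) (x : ℕ) (h : p (x+1)) : cnt p (x+1) = cnt p x + 1 := by
  classical
  unfold cnt
  rw [← Finset.insert_Icc_right_eq_Icc_add_one (by omega), Finset.filter_insert, if_pos h, Finset.card_insert_of_notMem]
  simp

theorem cnt_succ_neg (p : ℕ → Prop) (x : ℕ) (h : ¬ p (x+1)) : cnt p (x+1) = cnt p x := by
  classical
  unfold cnt
  rw [← Finset.insert_Icc_right_eq_Icc_add_one (by omega), Finset.filter_insert, if_neg h]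

theorem cnt_mono (p : ℕ → Prop) {x y : ℕ} (h : x ≤ y) :
    cnt p x ≤ cnt p y ∧ cnt p y + x ≤ cnt p x + y := by
  induction y, h using Nat.le_induction with
  | base => omega
  | succ y hy ih =>
    by_cases hp : p (y+1)
    · have := cnt_succ_pos p y hp; omega
    · have := cnt_succ_neg p y hp; omega

theorem cnt_not (p : ℕ → Prop) (x : ℕ) : cnt (fun y => ¬ p y) x + cnt p x = x := by
  induction x with
  | zero => simp [cnt_zero]
  | succ x ih =>
    by_cases hp : p (x+1)
    · have := cnt_succ_pos p x hp
      have := cnt_succ_neg (fun y => ¬ p y) x (by simpa using hp); omega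
    · have := cnt_succ_neg p x hp
      have := cnt_succ_pos (fun y => ¬ p y) x hp; omega

theorem inc_lt (u : ℕ → ℕ) (a b : ℕ) (h : ∀ i, a ≤ i → i < b → u i < u (i+1)) :
    ∀ i k, a ≤ i → i < k → k ≤ b → u i < u k := by
  intro i k hi hik hk
  induction k, hik using Nat.le_induction with
  | base => exact h i hi (by omega)
  | succ k hik ih => exact (ih (by omega)).trans (h k (by omega) (by omega))

/-- Counting lemma for an increasing run. -/
theorem run_count (u : ℕ → ℕ) (n a b : ℕ) (hb : b ≤ n) (A : ℕ → Prop)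
    (hu : Set.BijOn u (Set.Icc 1 n) (Set.Icc 1 n))
    (hA : ∀ i, 1 ≤ i → i ≤ n → (A (u i) ↔ a < i ∧ i ≤ b))
    (hinc : ∀ i k, a < i → i < k → k ≤ b → u i < u k)
    (i : ℕ) (h1 : a < i) (h2 : i ≤ b) : i = a + cnt A (u i) := by
  classical
  have key : (Finset.Icc 1 (u i)).filter A = (Finset.Ioc a i).image u := by
    ext y
    simp only [Finset.mem_filter, Finset.mem_Icc, Finset.mem_image, Finset.mem_Ioc]
    have hui := hu.mapsTo (show i ∈ Set.Icc 1 n from ⟨by omega, by omega⟩)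
    constructor
    · rintro ⟨⟨hy1, hy2⟩, hy⟩
      obtain ⟨k, hk, rfl⟩ := hu.surjOn (show y ∈ Set.Icc 1 n from ⟨hy1, hy2.trans hui.2⟩)
      have := (hA k hk.1 hk.2).1 hy
      refine ⟨k, ⟨this.1, ?_⟩, rfl⟩
      by_contra hlt
      have := hinc i k h1 (by omega) this.2
      omega
    · rintro ⟨k, ⟨hk1, hk2⟩, rfl⟩
      have hk := hu.mapsTo (show k ∈ Set.Icc 1 n from ⟨by omega, by omega⟩)
      refine ⟨⟨hk.1, ?_⟩, (hA k (by omega) (by omega)).2 ⟨hk1, by omega⟩⟩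
      rcases Nat.lt_or_ge k i with h | h
      · exact (hinc k i hk1 h h2).le
      · have : k = i := by omega
        rw [this]
  have hc : cnt A (u i) = i - a := by
    unfold cnt
    rw [key, Finset.card_image_of_injOn]
    · simp
    · intro x hx y hy hxy
      simp only [Finset.coe_Ioc, Set.mem_Ioc] at hx hy
      exact hu.injOn ⟨by omega, by omega⟩ ⟨by omega, by omega⟩ hxy
  omega

/-- Grassmann permutations in terms of counting functions. -/
theorem grass (u : ℕ → ℕ) (n j : ℕ) (hj : j ≤ n) (A : ℕ → Prop)
    (hu : Set.BijOn u (Set.Icc 1 n) (Set.Icc 1 n))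
    (hA : ∀ y, 1 ≤ y → y ≤ n → (A y ↔ ∃ i, 1 ≤ i ∧ i ≤ j ∧ u i = y))
    (hinc1 : ∀ i, 1 ≤ i → i < j → u i < u (i+1))
    (hinc2 : ∀ i, j + 1 ≤ i → i < n → u i < u (i+1)) (i : ℕ) (h1 : 1 ≤ i) (h2 : i ≤ n) :
    (i ≤ j ∧ A (u i) ∧ i = cnt A (u i)) ∨
    (j < i ∧ ¬ A (u i) ∧ i + cnt A (u i) = j + u i) := by
  have hA' : ∀ i, 1 ≤ i → i ≤ n → (A (u i) ↔ i ≤ j) := by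
    intro i h1 h2
    have hui := hu.mapsTo (show i ∈ Set.Icc 1 n from ⟨h1, h2⟩)
    rw [hA _ hui.1 hui.2]
    constructor
    · rintro ⟨k, hk1, hk2, hk⟩
      have := hu.injOn (show k ∈ Set.Icc 1 n from ⟨hk1, by omega⟩) ⟨h1, h2⟩ hk
      omega
    · intro h; exact ⟨i, h1, h, rfl⟩
  rcases Nat.lt_or_ge j i with h | h
  · right
    refine ⟨h, by rw [hA' i h1 h2]; omega, ?_⟩
    have := run_count u n j n le_rfl (fun y => ¬ A y) hu (by
      intro k hk1 hk2; rw [hA' k hk1 hk2]; omega)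
      (fun a b h1 h2 h3 => inc_lt u (j+1) n hinc2 a b (by omega) h2 h3) i h h2
    have := cnt_not A (u i)
    omega
  · left
    refine ⟨h, (hA' i h1 h2).2 h, ?_⟩
    have := run_count u n 0 j hj A hu (by
      intro k hk1 hk2; rw [hA' k hk1 hk2]; omega)
      (fun a b h1 h2 h3 => inc_lt u 1 j hinc1 a b (by omega) h2 h3) i (by omega) h
    omega

theorem mono_le (f : ℕ → ℕ) (h : ∀ i, 1 ≤ i → f (i+1) ≤ f i) :
    ∀ i k, 1 ≤ i → i ≤ k → f k ≤ f i := by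
  intro i k hi hik
  induction k, hik using Nat.le_induction with
  | base => exact le_rfl
  | succ k hik ih => exact (h k (by omega)).trans ih

/-- The permutation attached to a partition in a rectangle. -/
theorem grass_phi (R c n : ℕ) (hn : n = R + c) (η : ℕ → ℕ)
    (hmono : ∀ i k, 1 ≤ i → i ≤ k → k ≤ R → η k ≤ η i)
    (u : ℕ → ℕ) (hu : Set.BijOn u (Set.Icc 1 n) (Set.Icc 1 n))
    (hdef : ∀ i, 1 ≤ i → i ≤ c → u i = transposeFn R (complRect R c η) (c + 1 - i) + i)
    (hinc : ∀ i, c + 1 ≤ i → i < n → u i < u (i+1))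
    (B : ℕ → Prop)
    (hB : ∀ y, 1 ≤ y → y ≤ n → (B y ↔ ∃ k, 1 ≤ k ∧ k ≤ R ∧ y = η k + (R - k) + 1))
    (hcard : cnt B n = R) (i : ℕ) (h1 : 1 ≤ i) (h2 : i ≤ n) :
    (i ≤ c ∧ ¬ B (u i) ∧ i + cnt B (u i) = u i) ∨
    (c < i ∧ B (u i) ∧ i = c + cnt B (u i)) := by
  classical
  have hT : ∀ i, 1 ≤ i → i ≤ c → transposeFn R (complRect R c η) (c+1-i)
      = ((Finset.Icc 1 R).filter (fun p => η (R + 1 - p) < i)).card := by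
    intro i h1 h2
    unfold transposeFn complRect
    congr 1
    ext p
    simp only [Finset.mem_filter, Finset.mem_Icc]
    constructor
    · rintro ⟨hp, h⟩; rw [if_pos hp] at h; exact ⟨hp, by omega⟩
    · rintro ⟨hp, h⟩; rw [if_pos hp]; exact ⟨hp, by omega⟩
  have hinc1 : ∀ i, 1 ≤ i → i < c → u i < u (i+1) := by
    intro i h1 h2
    rw [hdef i h1 h2.le, hdef (i+1) (by omega) (by omega), hT i h1 h2.le, hT (i+1) (by omega) (by omega)]
    have : ((Finset.Icc 1 R).filter (fun p => η (R + 1 - p) < i)).card ≤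
      ((Finset.Icc 1 R).filter (fun p => η (R + 1 - p) < i + 1)).card := by
      apply Finset.card_le_card
      intro p
      simp only [Finset.mem_filter]
      rintro ⟨a, b⟩; exact ⟨a, by omega⟩
    omega
  have hnb : ∀ i, 1 ≤ i → i ≤ c → ¬ B (u i) := by
    intro i h1 h2 hb
    have hui := hu.mapsTo (show i ∈ Set.Icc 1 n from ⟨h1, by omega⟩)
    obtain ⟨k, hk1, hk2, hk⟩ := (hB _ hui.1 hui.2).1 hb
    rw [hdef i h1 h2, hT i h1 h2] at hk
    rcases Nat.lt_or_ge (η k) i with h | h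
    · have : (Finset.Icc 1 (R+1-k)).card ≤ ((Finset.Icc 1 R).filter (fun p => η (R + 1 - p) < i)).card := by
        apply Finset.card_le_card
        intro p
        simp only [Finset.mem_filter, Finset.mem_Icc]
        intro hp
        exact ⟨by omega, (hmono k (R+1-p) hk1 (by omega) (by omega)).trans_lt h⟩
      simp at this
      omega
    · have : ((Finset.Icc 1 R).filter (fun p => η (R + 1 - p) < i)).card ≤ (Finset.Icc 1 (R-k)).card := by
        apply Finset.card_le_card
        intro p
        simp only [Finset.mem_filter, Finset.mem_Icc]
        rintro ⟨hp, hlt⟩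
        refine ⟨hp.1, ?_⟩
        by_contra hc
        have := hmono (R+1-p) k (by omega) (by omega) hk2
        omega
      simp at this
      omega
  have hset : (Finset.Icc 1 c).image u = (Finset.Icc 1 n).filter (fun y => ¬ B y) := by
    apply Finset.eq_of_subset_of_card_le
    · intro y
      simp only [Finset.mem_image, Finset.mem_filter, Finset.mem_Icc]
      rintro ⟨k, hk, rfl⟩
      exact ⟨hu.mapsTo (show k ∈ Set.Icc 1 n from ⟨hk.1, by omega⟩), hnb k hk.1 hk.2⟩
    · rw [Finset.card_image_of_injOn]
      · have := cnt_not B n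
        have e : cnt (fun y => ¬ B y) n = ((Finset.Icc 1 n).filter (fun y => ¬ B y)).card := by
          unfold cnt; congr
        simp only [Nat.card_Icc]
        omega
      · intro x hx y hy hxy
        simp only [Finset.coe_Icc, Set.mem_Icc] at hx hy
        exact hu.injOn ⟨by omega, by omega⟩ ⟨by omega, by omega⟩ hxy
  have := grass u n c (by omega) (fun y => ¬ B y) hu (by
    intro y hy1 hy2
    have := congrArg (fun s => y ∈ s) hset
    simp only [Finset.mem_image, Finset.mem_filter, Finset.mem_Icc, eq_iff_iff] at this
    constructor
    · intro h
      obtain ⟨k, hk, e⟩ := this.2 ⟨⟨hy1, hy2⟩, h⟩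
      exact ⟨k, hk.1, hk.2, e⟩
    · rintro ⟨k, hk1, hk2, e⟩
      exact (this.1 ⟨k, ⟨hk1, hk2⟩, e⟩).2) hinc1 hinc i h1 h2
  have e := cnt_not B (u i)
  rcases this with ⟨a, b, c⟩ | ⟨a, b, c⟩
  · left; exact ⟨a, b, by omega⟩
  · right; exact ⟨a, not_not.1 b, by omega⟩
/-- bead of `f` at content `c`. -/
def Bead (f : ℕ → ℕ) (c : ℤ) : Prop := ∃ j : ℕ, 1 ≤ j ∧ (f j : ℤ) - j = c

theorem cross (S : Set (ℕ × ℕ)) (j : ℕ) (x y : ℕ × ℕ)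
    (h : Relation.ReflTransGen (fun a b => a ∈ S ∧ b ∈ S ∧ AdjCell a b) x y)
    (hx : x.1 ≤ j) : j < y.1 → ∃ c, (j, c) ∈ S ∧ (j+1, c) ∈ S := by
  induction h with
  | refl => intro h; omega
  | @tail b c hb hbc ih =>
    intro hj
    rcases Nat.lt_or_ge j b.1 with h | h
    · exact ih h
    · obtain ⟨hbS, hcS, hadj⟩ := hbc
      rcases hadj with ⟨h1, h2⟩ | ⟨h1, h2⟩
      · omega
      · have e1 : b.1 = j := by omega
        have e2 : c.1 = j + 1 := by omega
        refine ⟨b.2, ?_, ?_⟩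
        · rw [← e1]; exact hbS
        · rw [← e2, h1]; exact hcS

theorem rim (m r n : ℕ) (hm : 0 < m) (hn : n = m + r) (μ lam : ℕ → ℕ)
    (hμ : ∀ i, 1 ≤ i → μ (i+1) ≤ μ i) (hμr : ∀ i, 1 ≤ i → μ i ≤ r)
    (hμz : ∀ i, 2 * m < i → μ i = 0)
    (h : AddRimHook n r μ lam) :
    ∃ i0 : ℕ, 1 ≤ i0 ∧ ¬ Bead μ ((r:ℤ) - i0) ∧ (∀ j : ℕ, 1 ≤ j → j < i0 → Bead μ ((r:ℤ) - j)) ∧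
      (∀ c, Bead lam c ↔ (Bead μ c ∧ c ≠ (r:ℤ) - i0 - n) ∨ c = (r:ℤ) - i0) ∧
      (∀ i, 1 ≤ i → lam (i+1) ≤ lam i) ∧ (∀ i, 1 ≤ i → lam i ≤ r) ∧
      (i0 ≤ m → ∀ i, 2 * m < i → lam i = 0) := by
  obtain ⟨⟨hlam, -⟩, hle, hcard, hconn, hno, i0, hi0, hhead⟩ := h
  have hfin : (skewCells μ lam).Finite := Set.finite_of_ncard_ne_zero (by omega)
  have hM := mono_le μ hμ
  have hL := mono_le lam hlam
  simp only [skewCells, Set.mem_ofPred_eq] at hi0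
  obtain ⟨hi1, hi2, hi3⟩ := hi0
  have hmem : ∀ a b, (a, b) ∈ skewCells μ lam ↔ 1 ≤ a ∧ μ a < b ∧ b ≤ lam a := by
    intro a b; rfl
  have hlr : lam i0 = r := by
    have := (hhead (i0, lam i0) ((hmem _ _).2 ⟨hi1, by omega, le_rfl⟩)).2
    simp at this; omega
  have hlow : ∀ j, 1 ≤ j → j < i0 → lam j = r ∧ μ j = r := by
    intro j h1 h2
    have e : lam j = μ j := by
      by_contra hne
      have := hle j
      have := (hhead (j, lam j) ((hmem _ _).2 ⟨h1, by omega, le_rfl⟩)).1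
      simp at this; omega
    have := hL j i0 h1 h2.le
    have := hμr j h1
    omega
  -- last row
  obtain ⟨⟨k, ck⟩, hkS, hkmax⟩ := Set.exists_max_image (skewCells μ lam) Prod.fst hfin
    ⟨(i0, r), (hmem _ _).2 ⟨hi1, hi2, hi3⟩⟩
  have hk := (hmem _ _).1 hkS
  have hik : i0 ≤ k := (hhead _ hkS).1
  have hhigh : ∀ j, k < j → lam j = μ j := by
    intro j h1
    by_contra hne
    have := hle j
    have := hkmax (j, lam j) ((hmem _ _).2 ⟨by omega, by omega, le_rfl⟩)
    simp at this; omega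
  have hmid : ∀ j, i0 ≤ j → j < k → lam (j+1) = μ j + 1 := by
    intro j h1 h2
    obtain ⟨c, hc1, hc2⟩ := cross _ j (i0, r) (k, ck)
      (hconn _ ((hmem _ _).2 ⟨hi1, hi2, hi3⟩) _ hkS) h1 h2
    rw [hmem] at hc1 hc2
    by_contra hne
    apply hno
    have a1 := hlam j (by omega)
    have a2 := hμ j (by omega)
    refine ⟨j, μ j + 1, ?_, ?_, ?_, ?_⟩ <;> rw [hmem] <;> refine ⟨by omega, by omega, by omega⟩
  -- counting
  have hsum : ∀ k', i0 ≤ k' → k' ≤ k →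
      ∑ j ∈ Finset.Ico i0 k', ((lam j : ℤ) - μ j) = (lam i0 : ℤ) - lam k' + (k' - i0) := by
    intro k' h1
    induction k', h1 using Nat.le_induction with
    | base => intro _; simp
    | succ k' h1 ih =>
      intro h2
      rw [Finset.sum_Ico_succ_top h1, ih (by omega), hmid k' h1 (by omega)]
      push_cast; ring
  have hS : skewCells μ lam = ↑((Finset.Ico i0 (k+1)).biUnion
      (fun j => (Finset.Ioc (μ j) (lam j)).image (fun c => (j, c)))) := by
    ext ⟨a, b⟩
    simp only [hmem, Finset.coe_biUnion, Set.mem_iUnion, Finset.coe_image, Set.mem_image, Finset.mem_coe,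
      Finset.mem_Ico, Finset.mem_Ioc, Prod.mk.injEq]
    constructor
    · intro hab
      have h1 := (hhead _ ((hmem a b).2 hab)).1
      have h2 := hkmax _ ((hmem a b).2 hab)
      simp at h1 h2
      exact ⟨a, ⟨h1, by omega⟩, b, ⟨hab.2.1, hab.2.2⟩, rfl, rfl⟩
    · rintro ⟨a', ha, b', hb, rfl, rfl⟩
      exact ⟨by omega, hb⟩
  have hn2 : (n : ℤ) = (r : ℤ) - i0 - (μ k - k) := by
    rw [← hcard, hS, Set.ncard_coe_finset, Finset.card_biUnion]
    · have : ∀ j ∈ Finset.Ico i0 (k+1), (((Finset.Ioc (μ j) (lam j)).image (fun c => (j, c))).card : ℤ)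
          = (lam j : ℤ) - μ j := by
        intro j _
        rw [Finset.card_image_of_injective _ (by intro a b; simp)]
        have := hle j
        simp; omega
      push_cast
      rw [Finset.sum_congr rfl this, Finset.sum_Ico_succ_top hik, hsum k hik le_rfl, hlr]
      ring
    · intro a _ b _ hab
      rw [Function.onFun, Finset.disjoint_left]
      intro x hx hx'
      simp only [Finset.mem_image] at hx hx'
      obtain ⟨_, _, rfl⟩ := hx
      obtain ⟨_, _, e⟩ := hx'
      simp at e; omega
  refine ⟨i0, hi1, ?_, ?_, ?_, hlam, ?_, ?_⟩
  · rintro ⟨j, hj1, hj⟩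
    rcases Nat.lt_or_ge j i0 with h | h
    · have := hlow j hj1 h; omega
    · have := hM i0 j hi1 h; omega
  · intro j h1 h2
    exact ⟨j, h1, by rw [(hlow j h1 h2).2]⟩
  · intro c
    constructor
    · rintro ⟨j, hj1, rfl⟩
      rcases Nat.lt_trichotomy j i0 with h | h | h
      · left
        have := hlow j hj1 h
        exact ⟨⟨j, hj1, by omega⟩, by omega⟩
      · right; rw [h, hlr]
      · left
        rcases Nat.lt_or_ge k j with h' | h'
        · have e := hhigh j h'
          have := hM k j (by omega) h'.le
          exact ⟨⟨j, hj1, by omega⟩, by omega⟩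
        · obtain ⟨j, rfl⟩ : ∃ j', j = j' + 1 := ⟨j - 1, by omega⟩
          have e := hmid j (by omega) (by omega)
          have := hM j k (by omega) (by omega)
          exact ⟨⟨j, by omega, by omega⟩, by omega⟩
    · rintro (⟨⟨j, hj1, rfl⟩, hne⟩ | rfl)
      · rcases Nat.lt_or_ge j i0 with h | h
        · have := hlow j hj1 h
          exact ⟨j, hj1, by omega⟩
        · rcases Nat.lt_trichotomy j k with h' | h' | h'
          · have e := hmid j h h'
            exact ⟨j+1, by omega, by omega⟩
          · subst h'; omega
          · have e := hhigh j h'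
            exact ⟨j, hj1, by omega⟩
      · exact ⟨i0, hi1, by rw [hlr]⟩
  · intro i h1
    rcases Nat.lt_or_ge i i0 with h | h
    · exact (hlow i h1 h).1.le
    · rw [← hlr]; exact hL i0 i hi1 h
  · intro him i hi
    have hk2 : k ≤ 2 * m := by
      by_contra hc
      have := hμz k (by omega)
      omega
    rw [hhigh i (by omega), hμz i hi]

open Classical in
/-- Invariant along the chain of rim hook additions. -/
structure ChainInv (m r : ℕ) (ν f : ℕ → ℕ) (a : ℕ) (T : ℤ) : Prop where
  mono : ∀ i, 1 ≤ i → f (i+1) ≤ f i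
  bd : ∀ i, 1 ≤ i → f i ≤ r
  zero : ∀ i, 2 * m < i → f i = 0
  T1 : (r:ℤ) - m - 1 ≤ T
  T2 : T ≤ (r:ℤ) - 1
  top : ∀ c : ℤ, T < c → c ≤ (r:ℤ) - 1 → Bead f c
  win : ∀ c : ℤ, -(m:ℤ) ≤ c → c ≤ T → (Bead f c ↔ Bead ν c)
  low : ∀ c : ℤ, T - (m + r) < c → c < -(m:ℤ) → (Bead f c ↔ Bead ν (c + (m + r)))
  bot : ∀ c : ℤ, c ≤ T - (m + r) → Bead f c
  card : ((Finset.Ioc T ((r:ℤ)-1)).filter (fun c => ¬ Bead ν c)).card = a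

theorem inv_base (m r : ℕ) (ν : ℕ → ℕ)
    (hνmono : ∀ i, 1 ≤ i → ν (i + 1) ≤ ν i)
    (hνzero : ∀ i, m < i → ν i = 0)
    (hνbd : ν 1 ≤ r) : ChainInv m r ν ν 0 ((r:ℤ)-1) where
  mono := hνmono
  bd := fun i hi => (mono_le ν hνmono 1 i le_rfl hi).trans hνbd
  zero := fun i hi => hνzero i (by omega)
  T1 := by omega
  T2 := le_rfl
  top := by intros; omega
  win := by intros; rfl
  low := by intros; omega
  bot := by
    intro c hc
    have : ν c.natAbs = 0 := hνzero _ (by omega)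
    exact ⟨c.natAbs, by omega, by omega⟩
  card := by simp

open Classical in
theorem inv_step (m r : ℕ) (hm : 0 < m) (ν f g : ℕ → ℕ) (a : ℕ) (T : ℤ)
    (hI : ChainInv m r ν f a T) (hg : AddRimHook (m + r) r f g)
    (hd : a < ((Finset.Ioc ((r:ℤ)-m-1) ((r:ℤ)-1)).filter (fun c => ¬ Bead ν c)).card) :
    ∃ T', ChainInv m r ν g (a+1) T' := by
  obtain ⟨i0, h1, hnb, hbt, hbead, hmono, hbd, hz⟩ := rim m r (m+r) hm rfl f g hI.mono hI.bd hI.zero hg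
  have T1 := hI.T1
  have T2 := hI.T2
  obtain ⟨c0, hc0, hc0T, hc0N⟩ : ∃ c0 : ℤ, (r:ℤ) - m ≤ c0 ∧ c0 ≤ T ∧ ¬ Bead ν c0 := by
    by_contra hcon
    push Not at hcon
    rw [← hI.card] at hd
    apply absurd hd
    rw [not_lt]
    apply Finset.card_le_card
    intro c
    simp only [Finset.mem_filter, Finset.mem_Ioc]
    rintro ⟨⟨a1, a2⟩, a3⟩
    refine ⟨⟨?_, a2⟩, a3⟩
    by_contra hc
    exact a3 (hcon c (by omega) (by omega))
  have hi0c : c0 ≤ (r:ℤ) - i0 := by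
    by_contra hc
    have := hbt ((r:ℤ) - c0).toNat (by omega) (by omega)
    rw [show (r:ℤ) - (((r:ℤ) - c0).toNat : ℤ) = c0 by omega, hI.win c0 (by omega) hc0T] at this
    exact hc0N this
  have hi0T : (r:ℤ) - i0 ≤ T := by
    by_contra hc
    exact hnb (hI.top _ (by omega) (by omega))
  have hab : ∀ c : ℤ, (r:ℤ) - i0 < c → c ≤ (r:ℤ) - 1 → Bead f c := by
    intro c h2 h3
    have := hbt ((r:ℤ) - c).toNat (by omega) (by omega)
    rwa [show (r:ℤ) - (((r:ℤ) - c).toNat : ℤ) = c by omega] at this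
  have hnbN : ¬ Bead ν ((r:ℤ) - i0) := by
    rwa [← hI.win _ (by omega) hi0T]
  refine ⟨(r:ℤ) - i0 - 1, hmono, hbd, hz (by omega), by omega, by omega, ?_, ?_, ?_, ?_, ?_⟩
  · intro c h2 h3
    rw [hbead]
    by_cases h : c = (r:ℤ) - i0
    · right; exact h
    · left; exact ⟨hab c (by omega) h3, by push_cast; omega⟩
  · intro c h2 h3
    rw [hbead, ← hI.win c h2 (by omega)]
    constructor
    · rintro (⟨h, -⟩ | h)
      · exact h
      · omega
    · intro h; left; exact ⟨h, by push_cast; omega⟩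
  · intro c h2 h3
    rw [hbead]
    by_cases e : c = (r:ℤ) - i0 - (m + r)
    · rw [show c + ((m:ℤ) + r) = (r:ℤ) - i0 by omega]
      constructor
      · rintro (⟨_, h⟩ | h)
        · push_cast at h; omega
        · omega
      · intro h; exact absurd h hnbN
    · by_cases e2 : c ≤ T - (m + r)
      · constructor
        · intro _
          rw [← hI.win _ (by omega) (by omega)]
          exact hab _ (by omega) (by omega)
        · intro _; left; exact ⟨hI.bot c e2, by push_cast; omega⟩
      · rw [← hI.low c (by omega) h3]
        constructor
        · rintro (⟨h, -⟩ | h)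
          · exact h
          · omega
        · intro h; left; exact ⟨h, by push_cast; omega⟩
  · intro c h2
    rw [hbead]; left; exact ⟨hI.bot c (by omega), by push_cast; omega⟩
  · rw [← hI.card]
    have : (Finset.Ioc ((r:ℤ) - i0 - 1) ((r:ℤ)-1)).filter (fun c => ¬ Bead ν c)
        = insert ((r:ℤ) - i0) ((Finset.Ioc T ((r:ℤ)-1)).filter (fun c => ¬ Bead ν c)) := by
      ext c
      simp only [Finset.mem_filter, Finset.mem_Ioc, Finset.mem_insert]
      constructor
      · rintro ⟨⟨a1, a2⟩, a3⟩
        by_cases e : c = (r:ℤ) - i0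
        · left; exact e
        · right
          refine ⟨⟨?_, a2⟩, a3⟩
          by_contra hc
          apply a3
          rw [← hI.win c (by omega) (by omega)]
          exact hab c (by omega) a2
      · rintro (h | ⟨⟨a1, a2⟩, a3⟩)
        · subst h; exact ⟨⟨by omega, by omega⟩, hnbN⟩
        · exact ⟨⟨by omega, a2⟩, a3⟩
    rw [this, Finset.card_insert_of_notMem]
    simp only [Finset.mem_filter, Finset.mem_Ioc]
    omega

open Classical in
theorem inv_chain (m r : ℕ) (hm : 0 < m) (ν : ℕ → ℕ)
    (hνmono : ∀ i, 1 ≤ i → ν (i + 1) ≤ ν i)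
    (hνzero : ∀ i, m < i → ν i = 0)
    (hνbd : ν 1 ≤ r) (d : ℕ) (μ : ℕ → ℕ) (hμ : OplusChain (m+r) r d ν μ)
    (hd : d ≤ ((Finset.Ioc ((r:ℤ)-m-1) ((r:ℤ)-1)).filter (fun c => ¬ Bead ν c)).card) :
    ∃ T, ChainInv m r ν μ d T := by
  obtain ⟨f, h0, hfd, hf⟩ := hμ
  have : ∀ a, a ≤ d → ∃ T, ChainInv m r ν (f a) a T := by
    intro a
    induction a with
    | zero => intro _; rw [h0]; exact ⟨_, inv_base m r ν hνmono hνzero hνbd⟩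
    | succ a ih =>
      intro h
      obtain ⟨T, hT⟩ := ih (by omega)
      exact inv_step m r hm ν _ _ a T hT (hf a (by omega)) (by omega)
  rw [← hfd]; exact this d le_rfl
open Classical in
theorem diag_facts (m r : ℕ) (f : ℕ → ℕ) (hmono : ∀ i, 1 ≤ i → f (i+1) ≤ f i)
    (hbd : ∀ i, 1 ≤ i → f i ≤ r) (t : ℕ) (ht : t = diag0 (m+r) (complRect m r f)) :
    t ≤ m ∧ (∀ k : ℕ, 1 ≤ k → (k ≤ m - t ↔ (r:ℤ) - m ≤ (f k : ℤ) - k)) ∧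
    ((Finset.Ioc ((r:ℤ)-m-1) ((r:ℤ)-1)).filter (fun c => ¬ Bead f c)).card = t := by
  have hM := mono_le f hmono
  have e1 : t = ((Finset.Icc 1 m).filter (fun k : ℕ => ¬ ((r:ℤ) - m ≤ (f k : ℤ) - k))).card := by
    rw [ht]
    unfold diag0 complRect
    apply Finset.card_bij' (fun i _ => m + 1 - i) (fun i _ => m + 1 - i)
    · intro i
      simp only [Finset.mem_filter, Finset.mem_Icc]
      rintro ⟨h1, h2⟩
      split_ifs at h2 with h
      · exact ⟨by omega, by omega⟩
      · omega
    · intro i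
      simp only [Finset.mem_filter, Finset.mem_Icc]
      rintro ⟨h1, h2⟩
      rw [if_pos (by omega), show m + 1 - (m + 1 - i) = i by omega]
      exact ⟨by omega, by omega⟩
    · intro i
      simp only [Finset.mem_filter, Finset.mem_Icc]
      rintro ⟨h1, h2⟩
      split_ifs at h2 with h <;> omega
    · intro i
      simp only [Finset.mem_filter, Finset.mem_Icc]
      rintro ⟨h1, h2⟩
      omega
  have e2 := Finset.card_filter_add_card_filter_not (s := Finset.Icc 1 m) (fun k : ℕ => ((r:ℤ) - m ≤ (f k : ℤ) - k))
  rw [← e1, Nat.card_Icc] at e2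
  have hrow : ∀ k : ℕ, 1 ≤ k → (k ≤ m - t ↔ (r:ℤ) - m ≤ (f k : ℤ) - k) := by
    intro k hk
    rcases Nat.lt_or_ge m k with h | h
    · have := hbd k hk
      omega
    · by_cases hP : (r:ℤ) - m ≤ (f k : ℤ) - k
      · have : (Finset.Icc 1 k).card ≤ ((Finset.Icc 1 m).filter (fun k : ℕ => ((r:ℤ) - m ≤ (f k : ℤ) - k))).card := by
          apply Finset.card_le_card
          intro p
          simp only [Finset.mem_filter, Finset.mem_Icc]
          intro hp
          have := hM p k hp.1 hp.2
          exact ⟨by omega, by omega⟩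
        simp only [Nat.card_Icc] at this
        omega
      · have : ((Finset.Icc 1 m).filter (fun k : ℕ => ((r:ℤ) - m ≤ (f k : ℤ) - k))).card ≤ (Finset.Icc 1 (k-1)).card := by
          apply Finset.card_le_card
          intro p
          simp only [Finset.mem_filter, Finset.mem_Icc]
          rintro ⟨hp, hp2⟩
          refine ⟨hp.1, ?_⟩
          by_contra hc
          have := hM k p hk (by omega)
          omega
        simp only [Nat.card_Icc] at this
        omega
  have e3 := Finset.card_filter_add_card_filter_not (s := Finset.Ioc ((r:ℤ)-m-1) ((r:ℤ)-1)) (fun c => Bead f c)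
  have e4 : (Finset.Ioc ((r:ℤ)-m-1) ((r:ℤ)-1)).filter (fun c => Bead f c)
      = (Finset.Icc 1 (m-t)).image (fun k : ℕ => (f k : ℤ) - k) := by
    ext c
    simp only [Finset.mem_filter, Finset.mem_Ioc, Finset.mem_image, Finset.mem_Icc]
    constructor
    · rintro ⟨h1, k, hk, rfl⟩
      exact ⟨k, ⟨hk, (hrow k hk).2 (by omega)⟩, rfl⟩
    · rintro ⟨k, hk, rfl⟩
      have := (hrow k hk.1).1 hk.2
      have := hbd k hk.1
      exact ⟨⟨by omega, by omega⟩, k, hk.1, rfl⟩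
  rw [e4, Finset.card_image_of_injOn, Int.card_Ioc, Nat.card_Icc] at e3
  · exact ⟨by omega, hrow, by omega⟩
  · intro x hx y hy hxy
    simp only [Finset.coe_Icc, Set.mem_Icc] at hx hy
    simp only at hxy
    rcases Nat.lt_trichotomy x y with h | h | h
    · have := hM x y hx.1 h.le; omega
    · exact h
    · have := hM y x hy.1 h.le; omega

theorem zeroAt_bead (m : ℕ) (ν : ℕ → ℕ) (hνzero : ∀ i, m < i → ν i = 0) (p : ℕ) (hp : 1 ≤ p) :
    ZeroAt m ν p ↔ Bead ν ((p:ℤ) - m - 1) := by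
  constructor
  · rintro ⟨i, h1, h2, h3⟩
    exact ⟨i, h1, by omega⟩
  · rintro ⟨i, h1, h2⟩
    have : i ≤ m := by
      by_contra hc
      have := hνzero i (by omega)
      omega
    exact ⟨i, h1, this, by omega⟩

theorem cnt_b2 (b : ℕ → Prop) (s x : ℕ) :
    (x ≤ s → cnt (fun y => y ≤ s ∨ b y) x = x) ∧
    (s ≤ x → cnt (fun y => y ≤ s ∨ b y) x + cnt b s = s + cnt b x) := by
  induction x with
  | zero =>
    refine ⟨fun _ => cnt_zero _, fun h => ?_⟩
    have : s = 0 := by omega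
    subst this; simp [cnt_zero]
  | succ x ih =>
    by_cases h : x + 1 ≤ s
    · have e := cnt_succ_pos (fun y => y ≤ s ∨ b y) x (Or.inl h)
      have i1 := ih.1 (by omega)
      refine ⟨fun _ => by omega, fun h' => ?_⟩
      have : s = x + 1 := by omega
      subst this; omega
    · refine ⟨fun h' => absurd h' h, fun _ => ?_⟩
      have i2 := ih.2 (by omega)
      by_cases hb : b (x+1)
      · have e := cnt_succ_pos (fun y => y ≤ s ∨ b y) x (Or.inr hb)
        have e' := cnt_succ_pos b x hb
        omega
      · have e := cnt_succ_neg (fun y => y ≤ s ∨ b y) x (by tauto)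
        have e' := cnt_succ_neg b x hb
        omega

/-- bead predicate of the first piece -/
def B1 (m r t s : ℕ) (b : ℕ → Prop) (y : ℕ) : Prop :=
  r < y + t ∧ y + t ≤ m + r ∧ (s < y + t - r ∨ b (y + t - r))

theorem cnt_b1 (m r t s : ℕ) (b : ℕ → Prop) (htr : t ≤ r) (hs : s ≤ m) (y : ℕ) :
    (y + t ≤ r → cnt (B1 m r t s b) y = 0) ∧
    (r ≤ y + t → y + t - r ≤ s → cnt (B1 m r t s b) y = cnt b (y + t - r)) ∧
    (r ≤ y + t → s ≤ y + t - r → y + t ≤ m + r →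
      cnt (B1 m r t s b) y + s = cnt b s + (y + t - r)) ∧
    (m + r ≤ y + t → cnt (B1 m r t s b) y + s = cnt b s + m) := by
  induction y with
  | zero =>
    rw [cnt_zero]
    have hb0 := cnt_zero b
    refine ⟨fun _ => rfl, fun h _ => ?_, fun h h' _ => ?_, fun h => ?_⟩
    · rw [show 0 + t - r = 0 by omega, cnt_zero]
    · have : s = 0 := by omega
      subst this; omega
    · have : s = 0 := by omega
      subst this; omega
  | succ y ih =>
    obtain ⟨i1, i2, i3, i4⟩ := ih
    by_cases c1 : y + 1 + t ≤ r
    · have e := cnt_succ_neg (B1 m r t s b) y (by unfold B1; omega)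
      have hb0 := cnt_zero b
      have e0 := i1 (by omega)
      rw [e, e0]
      refine ⟨fun _ => rfl, fun h _ => ?_, fun h h' _ => ?_, fun h => ?_⟩
      · rw [show y + 1 + t - r = 0 by omega, cnt_zero]
      · have : s = 0 := by omega
        subst this; omega
      · have : s = 0 := by omega
        subst this; omega
    · by_cases c2 : y + 1 + t - r ≤ s
      · have i2 := i2 (by omega) (by omega)
        have eq : cnt (B1 m r t s b) (y+1) = cnt b (y + 1 + t - r) := by
          have e : y + 1 + t - r = (y + t - r) + 1 := by omega
          by_cases hb : b (y + 1 + t - r)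
          · have := cnt_succ_pos (B1 m r t s b) y ⟨by omega, by omega, Or.inr hb⟩
            rw [e] at hb ⊢
            have := cnt_succ_pos b _ hb
            omega
          · have := cnt_succ_neg (B1 m r t s b) y (by
              rintro ⟨_, _, h | h⟩
              · omega
              · exact hb h)
            rw [e] at hb ⊢
            have := cnt_succ_neg b _ hb
            omega
        refine ⟨fun _ => by omega, fun _ _ => eq, fun h h' _ => ?_, fun h => ?_⟩
        · have : s = y + 1 + t - r := by omega
          rw [eq, this]
        · have e1 : s = y + 1 + t - r := by omega
          have e2 : m = s := by omega
          rw [eq, e2, ← e1]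
      · by_cases c3 : y + 1 + t ≤ m + r
        · have := cnt_succ_pos (B1 m r t s b) y ⟨by omega, by omega, Or.inl (by omega)⟩
          have := i3 (by omega) (by omega) (by omega)
          refine ⟨fun _ => by omega, fun _ _ => by omega, fun h h' _ => by omega, fun h => by omega⟩
        · have := cnt_succ_neg (B1 m r t s b) y (by unfold B1; omega)
          have := i4 (by omega)
          refine ⟨fun _ => by omega, fun _ _ => by omega, fun h h' _ => by omega, fun h => by omega⟩

/-- Proposition (prop:wP'eta): `φ_{r−t}(η_t^2) ∘ φ_{r+t}(η_t^1) = w_ρ ∘ w_0^{P'_t} ∘ w_0`,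
where `ν ⊕ d = (η_t^1, η_t^2)`, `t = diag_0((ν⊕d)^{∨_r})` and `ρ = φ^r(ν)`.
Here `u1 = φ_{r+t}(η_t^1) = w_{((η_t^1)^{∨_{r+t}})′}`, `u2 = φ_{r−t}(η_t^2)` and
`wρ = w_ρ` are described by their defining properties as Grassmann permutations. -/
theorem stmt13 (m r n : ℕ) (hm : 0 < m) (hr : 0 < r) (hn : n = m + r)
    (ν : ℕ → ℕ)
    (hνmono : ∀ i, 1 ≤ i → ν (i + 1) ≤ ν i)
    (hνzero : ∀ i, m < i → ν i = 0)
    (hνbd : ν 1 ≤ r)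
    (d : ℕ) (hd : d ≤ diag0 n (complRect m r ν))
    (μ : ℕ → ℕ) (hμ : OplusChain n r d ν μ)
    (t : ℕ) (ht : t = diag0 n (complRect m r μ))
    (ρ : ℕ → ℕ)
    (hρmono : ∀ i, 1 ≤ i → ρ (i + 1) ≤ ρ i)
    (hρzero : ∀ i, m < i → ρ i = 0)
    (hρbd : ρ 1 ≤ r)
    (hcyc : ∀ p, 1 ≤ p → p ≤ n →
      (ZeroAt m ρ p ↔ ((p ≤ m ∧ ZeroAt m ν (p + r)) ∨ (m < p ∧ ZeroAt m ν (p - m)))))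
    -- the split `ν ⊕ d = (η_t^1, η_t^2)`
    (η1 η2 : ℕ → ℕ)
    (hη1 : ∀ i, η1 i = if 1 ≤ i ∧ i ≤ m - t then μ i else 0)
    (hη2 : ∀ i, η2 i = if 1 ≤ i then μ (m - t + i) else 0)
    -- `wρ = w_ρ ∈ S_n^m`
    (wρ : ℕ → ℕ)
    (hwρ_bij : Set.BijOn wρ (Set.Icc 1 n) (Set.Icc 1 n))
    (hwρ_def : ∀ i, 1 ≤ i → i ≤ m → wρ i = ρ (m + 1 - i) + i)
    (hwρ_inc : ∀ i, m + 1 ≤ i → i < n → wρ i < wρ (i + 1))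
    -- `u1 = φ_{r+t}(η_t^1) = w_{((η_t^1)^{∨_{r+t}})′} ∈ S_n^{r+t}`
    (u1 : ℕ → ℕ)
    (hu1_bij : Set.BijOn u1 (Set.Icc 1 n) (Set.Icc 1 n))
    (hu1_def : ∀ i, 1 ≤ i → i ≤ r + t →
      u1 i = transposeFn (m - t) (complRect (m - t) (r + t) η1) ((r + t) + 1 - i) + i)
    (hu1_inc : ∀ i, r + t + 1 ≤ i → i < n → u1 i < u1 (i + 1))
    -- `u2 = φ_{r−t}(η_t^2) = w_{((η_t^2)^{∨_{r−t}})′} ∈ S_n^{r−t}`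
    (u2 : ℕ → ℕ)
    (hu2_bij : Set.BijOn u2 (Set.Icc 1 n) (Set.Icc 1 n))
    (hu2_def : ∀ i, 1 ≤ i → i ≤ r - t →
      u2 i = transposeFn (m + t) (complRect (m + t) (r - t) η2) ((r - t) + 1 - i) + i)
    (hu2_inc : ∀ i, r - t + 1 ≤ i → i < n → u2 i < u2 (i + 1)) :
    ∀ i, 1 ≤ i → i ≤ n → u2 (u1 i) = wρ (wPfun n m t (w0fun n i)) := by
  classical
  subst hn
  have hνbd' : ∀ i, 1 ≤ i → ν i ≤ r := fun i hi => (mono_le ν hνmono 1 i le_rfl hi).trans hνbd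
  obtain ⟨-, -, hδ⟩ := diag_facts m r ν hνmono hνbd' _ rfl
  rw [← hδ] at hd
  obtain ⟨T, hT⟩ := inv_chain m r hm ν hνmono hνzero hνbd d μ hμ hd
  obtain ⟨htm, hrow, htc⟩ := diag_facts m r μ hT.mono hT.bd t ht
  have T1 := hT.T1
  have T2 := hT.T2
  have hM := mono_le μ hT.mono
  obtain ⟨s, hs⟩ : ∃ s : ℕ, T = (s:ℤ) + r - m - 1 := ⟨(T - r + m + 1).toNat, by omega⟩
  have hsm : s ≤ m := by omega
  -- the bead predicate of ρ
  set b : ℕ → Prop := ZeroAt m ρ with hb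
  have hb1 : ∀ q : ℕ, 1 ≤ q → q ≤ m → (b q ↔ Bead ν ((q:ℤ) + r - m - 1)) := by
    intro q h1 h2
    have e := zeroAt_bead m ν hνzero (q + r) (by omega)
    rw [hcyc q h1 (by omega), show ((q:ℤ) + r - m - 1) = ((q + r : ℕ):ℤ) - m - 1 by push_cast; ring, ← e]
    constructor
    · rintro (h | h)
      · exact h.2
      · omega
    · intro h; exact Or.inl ⟨h2, h⟩
  have hb2 : ∀ q : ℕ, m < q → q ≤ m + r → (b q ↔ Bead ν ((q:ℤ) - 2 * m - 1)) := by
    intro q h1 h2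
    have e := zeroAt_bead m ν hνzero (q - m) (by omega)
    rw [hcyc q (by omega) h2, show ((q:ℤ) - 2 * m - 1) = ((q - m : ℕ):ℤ) - m - 1 by omega, ← e]
    constructor
    · rintro (h | h)
      · omega
      · exact h.2
    · intro h; exact Or.inr ⟨h1, h⟩
  -- wρ
  have Gρ := grass wρ (m+r) m (by omega) b hwρ_bij (by
    intro y hy1 hy2
    constructor
    · rintro ⟨i, h1, h2, h3⟩
      refine ⟨m + 1 - i, by omega, by omega, ?_⟩
      rw [hwρ_def _ (by omega) (by omega), show m + 1 - (m + 1 - i) = i by omega]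
      omega
    · rintro ⟨i, h1, h2, rfl⟩
      rw [hwρ_def i h1 h2]
      exact ⟨m + 1 - i, by omega, by omega, by omega⟩) (by
    intro i h1 h2
    rw [hwρ_def i h1 h2.le, hwρ_def (i+1) (by omega) (by omega)]
    have := hρmono (m - i) (by omega)
    rw [show m + 1 - (i + 1) = m - i by omega]
    rw [show m - i + 1 = m + 1 - i by omega] at this
    omega) hwρ_inc
  -- K(n) = m
  have hKn : cnt b (m + r) = m := by
    obtain ⟨z, hz, hze⟩ := hwρ_bij.surjOn (show m + r ∈ Set.Icc 1 (m + r) from ⟨by omega, le_rfl⟩)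
    have hub : cnt b (m + r) ≤ m := by
      rcases Gρ z hz.1 hz.2 with ⟨h1, h2, h3⟩ | ⟨h1, h2, h3⟩
      · rw [hze] at h3; omega
      · rw [hze] at h3
        have := hz.2
        obtain ⟨h4, h5⟩ := cnt_mono b (show 0 ≤ m + r by omega)
        have hmm := hwρ_bij.mapsTo (show m ∈ Set.Icc 1 (m + r) from ⟨hm, by omega⟩)
        have hr2 := hwρ_bij.mapsTo (show m + r ∈ Set.Icc 1 (m + r) from ⟨by omega, by omega⟩)
        rcases Gρ (m+r) (by omega) le_rfl with ⟨h1, h2, h3⟩ | ⟨h1, h2, h3'⟩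
        · omega
        · have := (cnt_mono b hr2.2).2
          omega
    have hmm := hwρ_bij.mapsTo (show m ∈ Set.Icc 1 (m + r) from ⟨hm, by omega⟩)
    rcases Gρ m hm (by omega) with ⟨h1, h2, h3⟩ | ⟨h1, h2, h3⟩
    · have := (cnt_mono b hmm.2).1
      omega
    · omega
  -- t = s - K(s)
  have hts : t + cnt b s = s := by
    have : t = cnt (fun y => ¬ b y) s := by
      rw [← htc]
      unfold cnt
      symm
      apply Finset.card_bij (fun (q : ℕ) _ => (q:ℤ) + r - m - 1)
      · intro q
        simp only [Finset.mem_filter, Finset.mem_Icc, Finset.mem_Ioc]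
        rintro ⟨h1, h2⟩
        refine ⟨by omega, ?_⟩
        rw [hT.win _ (by omega) (by omega), ← hb1 q h1.1 (by omega)]
        exact h2
      · intro x _ y _ h; omega
      · intro c
        simp only [Finset.mem_filter, Finset.mem_Icc, Finset.mem_Ioc]
        rintro ⟨h1, h2⟩
        have hcT : c ≤ T := by
          by_contra hc
          exact h2 (hT.top c (by omega) h1.2)
        refine ⟨(c - r + m + 1).toNat, ⟨by omega, ?_⟩, by omega⟩
        rw [hb1 _ (by omega) (by omega), ← hT.win _ (by omega) (by omega)]
        rwa [show (((c - r + m + 1).toNat : ℤ) + r - m - 1) = c by omega]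
    have := cnt_not b s
    omega
  have htr : t ≤ r := by
    have := (cnt_mono b (show s ≤ m + r by omega)).2
    omega
  have C1 := cnt_b1 m r t s b htr hsm
  have C2 := cnt_b2 b s
  -- u1
  have G1 := grass_phi (m - t) (r + t) (m + r) (by omega) η1 (by
    intro i k h1 h2 h3
    rw [hη1, hη1, if_pos (by omega), if_pos (by omega)]
    exact hM i k h1 h2) u1 hu1_bij hu1_def hu1_inc (B1 m r t s b) (by
    intro y hy1 hy2
    have e : (∃ k, 1 ≤ k ∧ k ≤ m - t ∧ y = η1 k + (m - t - k) + 1) ↔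
        (r:ℤ) - m ≤ (y:ℤ) + t - m - 1 ∧ Bead μ ((y:ℤ) + t - m - 1) := by
      constructor
      · rintro ⟨k, h1, h2, h3⟩
        rw [hη1, if_pos ⟨h1, h2⟩] at h3
        have := (hrow k h1).1 h2
        exact ⟨by omega, k, h1, by omega⟩
      · rintro ⟨h1, k, h2, h3⟩
        have h4 := (hrow k h2).2 (by omega)
        refine ⟨k, h2, h4, ?_⟩
        rw [hη1, if_pos ⟨h2, h4⟩]; omega
    rw [e]
    unfold B1
    constructor
    · rintro ⟨h1, h2, h3⟩
      refine ⟨by omega, ?_⟩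
      by_cases hq : s < y + t - r
      · exact hT.top _ (by omega) (by omega)
      · have h3 := h3.resolve_left hq
        rw [hb1 _ (by omega) (by omega)] at h3
        rw [hT.win _ (by omega) (by omega)]
        rwa [show (((y + t - r : ℕ) : ℤ) + r - m - 1) = (y:ℤ) + t - m - 1 by omega] at h3
    · rintro ⟨h1, h2⟩
      have hle : y + t ≤ m + r := by
        obtain ⟨k, hk1, hk2⟩ := h2
        have := hT.bd k hk1
        omega
      refine ⟨by omega, hle, ?_⟩
      by_cases hq : s < y + t - r
      · exact Or.inl hq
      · right
        rw [hb1 _ (by omega) (by omega)]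
        rw [hT.win _ (by omega) (by omega)] at h2
        rwa [show (((y + t - r : ℕ) : ℤ) + r - m - 1) = (y:ℤ) + t - m - 1 by omega]) (by
    have := (C1 (m+r)).2.2.2 (by omega)
    omega)
  -- u2
  have G2 := grass_phi (m + t) (r - t) (m + r) (by omega) η2 (by
    intro i k h1 h2 h3
    rw [hη2, hη2, if_pos (by omega), if_pos (by omega)]
    exact hM _ _ (by omega) (by omega)) u2 hu2_bij hu2_def hu2_inc (fun y => y ≤ s ∨ b y) (by
    intro y hy1 hy2
    have e : (∃ k, 1 ≤ k ∧ k ≤ m + t ∧ y = η2 k + (m + t - k) + 1) ↔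
        Bead μ ((y:ℤ) - 2 * m - 1) := by
      constructor
      · rintro ⟨k, h1, h2, h3⟩
        rw [hη2, if_pos h1] at h3
        exact ⟨m - t + k, by omega, by omega⟩
      · rintro ⟨k, h1, h2⟩
        have h3 : ¬ k ≤ m - t := by
          rw [hrow k h1]; omega
        have h4 : k ≤ 2 * m := by
          by_contra hc
          have := hT.zero k (by omega)
          omega
        refine ⟨k - (m - t), by omega, by omega, ?_⟩
        rw [hη2, if_pos (by omega), show m - t + (k - (m - t)) = k by omega]
        omega
    rw [e]
    by_cases hys : y ≤ s
    · exact ⟨fun _ => hT.bot _ (by omega), fun _ => Or.inl hys⟩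
    · have e2 : b y ↔ Bead μ ((y:ℤ) - 2 * m - 1) := by
        by_cases hym : y ≤ m
        · rw [hT.low _ (by omega) (by omega), hb1 y hy1 hym,
            show (y:ℤ) - 2 * m - 1 + (m + r) = (y:ℤ) + r - m - 1 by ring]
        · rw [hT.win _ (by omega) (by omega), hb2 y (by omega) hy2]
      rw [← e2]
      tauto) (by
    have := (C2 (m+r)).2 (by omega)
    omega)
  -- conclusion
  intro i hi1 hi2
  have hy := hu1_bij.mapsTo (show i ∈ Set.Icc 1 (m + r) from ⟨hi1, hi2⟩)
  have hx := hu2_bij.mapsTo hy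
  obtain ⟨z, hz, hzx⟩ := hwρ_bij.surjOn hx
  have g1 := G1 i hi1 hi2
  have g2 := G2 (u1 i) hy.1 hy.2
  have gρ := Gρ z hz.1 hz.2
  rw [hzx] at gρ
  generalize u2 (u1 i) = x at *
  generalize u1 i = y at *
  have hz1 := hz.1
  have hz2 := hz.2
  have hx1 := hx.1
  have hx2 := hx.2
  have hy1 := hy.1
  have hy2 := hy.2
  suffices hgoal : wPfun (m + r) m t (w0fun (m + r) i) = z by rw [hgoal, hzx]
  unfold wPfun w0fun
  have C1y := C1 y
  have C2x := C2 x
  have kx := cnt_mono b hx2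
  rw [hKn] at kx
  by_cases hxs : x ≤ s
  · have kxs := cnt_mono b hxs
    have c2 := C2x.1 hxs
    have g2' : y = r - t + x := by
      rcases g2 with ⟨h1, h2, h3⟩ | ⟨h1, h2, h3⟩
      · exact absurd (Or.inl hxs) h2
      · omega
    have hq : y + t - r = x := by omega
    have c1 := C1y.2.1 (by omega) (by omega)
    have hB : B1 m r t s b y ↔ b x := by
      unfold B1; rw [hq]
      constructor
      · rintro ⟨_, _, h | h⟩
        · omega
        · exact h
      · intro h; exact ⟨by omega, by omega, Or.inr h⟩
    rw [hB, c1, hq] at g1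
    rcases g1 with ⟨h1, h2, h3⟩ | ⟨h1, h2, h3⟩ <;> rcases gρ with ⟨h4, h5, h6⟩ | ⟨h4, h5, h6⟩
    · exact absurd h5 h2
    · split_ifs <;> omega
    · split_ifs <;> omega
    · exact absurd h2 h5
  · have c2 := C2x.2 (by omega)
    obtain ⟨x', rfl⟩ : ∃ x', x = x' + 1 := ⟨x - 1, by omega⟩
    have kx' := cnt_mono b (show s ≤ x' by omega)
    by_cases hbx : b (x' + 1)
    · have k1 := cnt_succ_pos b x' hbx
      have g2' : y = r + cnt b (x' + 1) := by
        rcases g2 with ⟨h1, h2, h3⟩ | ⟨h1, h2, h3⟩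
        · exact absurd (Or.inr hbx) h2
        · omega
      have gz : z = cnt b (x' + 1) := by
        rcases gρ with ⟨h4, h5, h6⟩ | ⟨h4, h5, h6⟩
        · exact h6
        · exact absurd hbx h5
      by_cases hqm : y + t ≤ m + r
      · have c1 := C1y.2.2.1 (by omega) (by omega) hqm
        have hB : B1 m r t s b y := ⟨by omega, hqm, Or.inl (by omega)⟩
        rcases g1 with ⟨h1, h2, h3⟩ | ⟨h1, h2, h3⟩
        · exact absurd hB h2
        · split_ifs <;> omega
      · have c1 := C1y.2.2.2 (by omega)
        rcases g1 with ⟨h1, h2, h3⟩ | ⟨h1, h2, h3⟩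
        · split_ifs <;> omega
        · exact absurd h2.2.1 hqm
    · have k1 := cnt_succ_neg b x' hbx
      have g2' : y + t + cnt b (x' + 1) = x' + 1 := by
        rcases g2 with ⟨h1, h2, h3⟩ | ⟨h1, h2, h3⟩
        · omega
        · rcases h2 with h2 | h2
          · exact absurd h2 hxs
          · exact absurd h2 hbx
      have gz : z + cnt b (x' + 1) = m + (x' + 1) := by
        rcases gρ with ⟨h4, h5, h6⟩ | ⟨h4, h5, h6⟩
        · exact absurd h5 hbx
        · exact h6
      have c1 := C1y.1 (by omega)
      rcases g1 with ⟨h1, h2, h3⟩ | ⟨h1, h2, h3⟩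
      · split_ifs <;> omega
      · exact absurd h2.1 (by omega)
end

section
/- Let n ≥ 2 and 1 ≤ j < n, and let λ ⊆ ((n−j)^j) be a partition with Grassmann permutation w_λ having one-line notation [w_1, …, w_n]. Then the Grassmann permutation of the partition (λ^{∨_{n−j}})′ ⊆ (j^{n−j}) is obtained by cycling the window by j: w_{(λ^{∨_{n−j}})′} = [w_{j+1}, …, w_n, w_1, …, w_j]. Equivalently, w_{(λ^{∨_{n−j}})′} = w_λ ∘ w_0^{P_j} ∘ w_0, where w_0^{P_j} ∈ S_n is given by w_0^{P_j}(i) = j+1−i for 1 ≤ i ≤ j and w_0^{P_j}(i) = n+j+1−i for j < i ≤ n, and w_0(i) = n+1−i. -/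
/-- The longest element `w_0^{P_j}` of `S_j × S_{n−j}`. -/
def wPj (n j : ℕ) : ℕ → ℕ := fun i => if i ≤ j then j + 1 - i else n + j + 1 - i

theorem step_mono_aux (m : ℕ) (f : ℕ → ℕ) (hf : ∀ i, 1 ≤ i → i < m → f i < f (i + 1)) :
    ∀ b a, 1 ≤ a → a < b → b ≤ m → f a < f b := by
  intro b
  induction b with
  | zero => intro a _ h; omega
  | succ b ih =>
    intro a h1 h2 h3
    have h4 := hf b (by omega) (by omega)
    rcases Nat.lt_or_ge a b with h | h
    · have := ih a h1 h (by omega)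
      omega
    · have : a = b := by omega
      subst this; exact h4

theorem inc_unique_aux (m : ℕ) (f g : ℕ → ℕ)
    (hf : ∀ i, 1 ≤ i → i < m → f i < f (i + 1))
    (hg : ∀ i, 1 ≤ i → i < m → g i < g (i + 1))
    (h : ∀ i, 1 ≤ i → i ≤ m → ∃ k, 1 ≤ k ∧ k ≤ m ∧ f i = g k) :
    ∀ i, 1 ≤ i → i ≤ m → f i = g i := by
  have hgm := step_mono_aux m g hg
  choose! φ h1 h2 h3 using h
  have hφ : ∀ i, 1 ≤ i → i < m → φ i < φ (i + 1) := by
    intro i hi hi'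
    by_contra hc
    have a1 := hf i hi hi'
    rw [h3 i hi (by omega), h3 (i + 1) (by omega) (by omega)] at a1
    rcases Nat.lt_or_ge (φ (i + 1)) (φ i) with h | h
    · have := hgm (φ i) (φ (i + 1)) (h1 _ (by omega) (by omega)) h (h2 _ hi (by omega))
      omega
    · have : φ (i + 1) = φ i := by omega
      rw [this] at a1; omega
  have lo : ∀ i, 1 ≤ i → i ≤ m → i ≤ φ i := by
    intro i hi
    induction i, hi using Nat.le_induction with
    | base => intro hm; exact h1 1 le_rfl hm
    | succ i hi ih =>
      intro hm
      have := ih (by omega)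
      have := hφ i hi (by omega)
      omega
  have hi : ∀ d i, 1 ≤ i → i + d = m → φ i ≤ i := by
    intro d
    induction d with
    | zero => intro i h h'; have := h2 i h (by omega); omega
    | succ d ih =>
      intro i h h'
      have := ih (i + 1) (by omega) (by omega)
      have := hφ i h (by omega)
      omega
  intro i hi1 hi2
  have e : φ i = i := le_antisymm (hi (m - i) i hi1 (by omega)) (lo i hi1 hi2)
  rw [h3 i hi1 hi2, e]

/-- Equation (eq:wdualtranspose): the window of `w_{(λ^{∨_{n−j}})′}` is obtained by
cycling the window of `w_λ` by `j`; equivalently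
`w_{(λ^{∨_{n−j}})′} = w_λ ∘ w_0^{P_j} ∘ w_0`. -/
theorem stmt19 (n j : ℕ) (hn : 2 ≤ n) (hj1 : 1 ≤ j) (hjn : j < n)
    (lam : ℕ → ℕ)
    (hmono : ∀ i, 1 ≤ i → lam (i + 1) ≤ lam i)
    (hzero : ∀ i, j < i → lam i = 0)
    (hbd : lam 1 ≤ n - j)
    -- `w = w_λ ∈ S_n^j`
    (w : ℕ → ℕ)
    (hw_bij : Set.BijOn w (Set.Icc 1 n) (Set.Icc 1 n))
    (hw_def : ∀ i, 1 ≤ i → i ≤ j → w i = lam (j + 1 - i) + i)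
    (hw_inc : ∀ i, j + 1 ≤ i → i < n → w i < w (i + 1))
    -- `v = w_{(λ^{∨_{n−j}})′} ∈ S_n^{n−j}`
    (v : ℕ → ℕ)
    (hv_bij : Set.BijOn v (Set.Icc 1 n) (Set.Icc 1 n))
    (hv_def : ∀ i, 1 ≤ i → i ≤ n - j →
      v i = transposeFn j (complRect j (n - j) lam) ((n - j) + 1 - i) + i)
    (hv_inc : ∀ i, n - j + 1 ≤ i → i < n → v i < v (i + 1)) :
    (∀ i, 1 ≤ i → i ≤ n - j → v i = w (j + i)) ∧
    (∀ i, 1 ≤ i → i ≤ j → v (n - j + i) = w i) ∧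
    (∀ i, 1 ≤ i → i ≤ n → v i = w (wPj n j (w0fun n i))) := by
  have hanti : ∀ b a, 1 ≤ a → a ≤ b → lam b ≤ lam a := by
    intro b a ha hab
    induction b, hab using Nat.le_induction with
    | base => exact le_rfl
    | succ b hb ih => exact (hmono b (by omega)).trans ih
  have hle : ∀ a, 1 ≤ a → lam a ≤ n - j := fun a ha => (hanti a 1 le_rfl ha).trans hbd
  -- the count in the transpose
  have hT : ∀ i, 1 ≤ i → i ≤ n - j → v i =
      ((Finset.Icc 1 j).filter (fun p => lam (j + 1 - p) < i)).card + i := by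
    intro i h1 h2
    rw [hv_def i h1 h2, transposeFn]
    congr 2
    apply Finset.filter_congr
    intro p hp
    rw [Finset.mem_Icc] at hp
    have := hle (j + 1 - p) (by omega)
    simp only [complRect, if_pos hp]
    omega
  have hne : ∀ i, 1 ≤ i → i ≤ n - j → ∀ p, 1 ≤ p → p ≤ j → v i ≠ w p := by
    intro i h1 h2 p hp1 hp2
    rw [hT i h1 h2, hw_def p hp1 hp2]
    by_cases hp : lam (j + 1 - p) < i
    · have hs : Finset.Icc 1 p ⊆ (Finset.Icc 1 j).filter (fun p => lam (j + 1 - p) < i) := by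
        intro q hq
        rw [Finset.mem_Icc] at hq
        rw [Finset.mem_filter, Finset.mem_Icc]
        have := hanti (j + 1 - q) (j + 1 - p) (by omega) (by omega)
        omega
      have := Finset.card_le_card hs
      rw [Nat.card_Icc] at this
      omega
    · have hs : (Finset.Icc 1 j).filter (fun p => lam (j + 1 - p) < i) ⊆ Finset.Icc 1 (p - 1) := by
        intro q hq
        rw [Finset.mem_filter, Finset.mem_Icc] at hq
        rw [Finset.mem_Icc]
        by_contra hc
        have := hanti (j + 1 - p) (j + 1 - q) (by omega) (by omega)
        omega
      have := Finset.card_le_card hs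
      rw [Nat.card_Icc] at this
      omega
  have hvinc1 : ∀ i, 1 ≤ i → i < n - j → v i < v (i + 1) := by
    intro i h1 h2
    rw [hT i h1 (by omega), hT (i + 1) (by omega) (by omega)]
    have hs : (Finset.Icc 1 j).filter (fun p => lam (j + 1 - p) < i) ⊆
        (Finset.Icc 1 j).filter (fun p => lam (j + 1 - p) < i + 1) := by
      intro q hq
      rw [Finset.mem_filter] at hq ⊢
      exact ⟨hq.1, by omega⟩
    have := Finset.card_le_card hs
    omega
  have hex : ∀ i, 1 ≤ i → i ≤ n → ∃ k, 1 ≤ k ∧ k ≤ n ∧ v i = w k := by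
    intro i h1 h2
    obtain ⟨k, hk, e⟩ := hw_bij.surjOn (hv_bij.mapsTo (Set.mem_Icc.2 ⟨h1, h2⟩))
    exact ⟨k, hk.1, hk.2, e.symm⟩
  have P1 : ∀ i, 1 ≤ i → i ≤ n - j → v i = w (j + i) := by
    apply inc_unique_aux (n - j) v (fun i => w (j + i)) hvinc1
    · intro i h1 h2
      exact hw_inc (j + i) (by omega) (by omega)
    · intro i h1 h2
      obtain ⟨k, k1, k2, e⟩ := hex i h1 (by omega)
      have hk : j < k := by
        by_contra hc
        exact hne i h1 h2 k k1 (by omega) e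
      refine ⟨k - j, by omega, by omega, ?_⟩
      show v i = w (j + (k - j))
      rw [e]; congr 1; omega
  have hwinc1 : ∀ i, 1 ≤ i → i < j → w i < w (i + 1) := by
    intro i h1 h2
    rw [hw_def i h1 (by omega), hw_def (i + 1) (by omega) (by omega)]
    have := hanti (j + 1 - i) (j + 1 - (i + 1)) (by omega) (by omega)
    omega
  have P2 : ∀ i, 1 ≤ i → i ≤ j → v (n - j + i) = w i := by
    apply inc_unique_aux j (fun i => v (n - j + i)) w _ hwinc1
    · intro i h1 h2
      obtain ⟨k, k1, k2, e⟩ := hex (n - j + i) (by omega) (by omega)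
      refine ⟨k, k1, ?_, e⟩
      by_contra hc
      have e2 := P1 (k - j) (by omega) (by omega)
      rw [show j + (k - j) = k by omega, ← e] at e2
      have := hv_bij.injOn (Set.mem_Icc.2 ⟨by omega, by omega⟩)
        (Set.mem_Icc.2 ⟨by omega, by omega⟩) e2
      omega
    · intro i h1 h2
      exact hv_inc (n - j + i) (by omega) (by omega)
  refine ⟨P1, P2, ?_⟩
  intro i h1 h2
  unfold wPj w0fun
  by_cases h : i ≤ n - j
  · rw [P1 i h1 h]
    congr 1
    split_ifs <;> omega
  · have := P2 (i - (n - j)) (by omega) (by omega)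
    rw [show n - j + (i - (n - j)) = i by omega] at this
    rw [this]
    congr 1
    split_ifs <;> omega
end
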